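/- arXiv:math/0701346 — 2 statements merged into one kernel-verified Lean document; each statement's English description precedes it below -/
import Mathlib

section
/- Let (G_n) be a sequence of weighted graphs with |G_n| = n and β_max = sup_{i,j,n} β_ij(n) < ∞, converging to a graphon W with ‖T_W‖ < 1. Then there is a constant A such that with high probability the largest component of G_n(1/n) has at most A·log n vertices. -/
open MeasureTheory Filter Topology

noncomputable section

namespace Percolation

/-- The symmetrized lift of a two-variable real function to `Sym2`. If `f` is symmetric,
`sym2Val f s(a, b) = f a b`. -/
def sym2Val {α : Type*} (f : α → α → ℝ) : Sym2 α → ℝ :=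
  Sym2.lift ⟨fun a b => (f a b + f b a) / 2, fun a b => by simp [add_comm]⟩

/-- The product over the edges of `F` of a symmetric function of the endpoints. -/
def edgeProd {k : ℕ} (F : SimpleGraph (Fin k)) (f : Fin k → Fin k → ℝ) : ℝ := by
  classical exact ∏ e ∈ F.edgeFinset, sym2Val f e

/-- The homomorphism density `t(F, G)` of a finite simple graph `F` in the weighted graph
on `[n]` with edge weights `β`. -/
def homDensityG {n k : ℕ} (β : Fin n → Fin n → ℝ) (F : SimpleGraph (Fin k)) : ℝ :=
  (∑ v : Fin k → Fin n, edgeProd F fun i j => β (v i) (v j)) / (n : ℝ) ^ k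

/-- The unit interval `[0,1] ⊆ ℝ`. -/
def I01 : Set ℝ := Set.Icc 0 1

/-- The homomorphism density `t(F, W)` of a finite simple graph `F` in a graphon `W`. -/
def homDensityW {k : ℕ} (W : ℝ → ℝ → ℝ) (F : SimpleGraph (Fin k)) : ℝ :=
  ∫ x : Fin k → ℝ in Set.univ.pi fun _ => I01, edgeProd F fun i j => W (x i) (x j)

/-- `G_n → W`: convergence of the homomorphism densities for every finite simple graph. -/
def ConvergesTo (β : ∀ n : ℕ, Fin n → Fin n → ℝ) (W : ℝ → ℝ → ℝ) : Prop :=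
  ∀ (k : ℕ) (F : SimpleGraph (Fin k)),
    Tendsto (fun n => homDensityG (β n) F) atTop (nhds (homDensityW W F))

/-- `W` is a graphon: a bounded symmetric measurable function with nonnegative values. -/
def IsGraphon (W : ℝ → ℝ → ℝ) : Prop :=
  Measurable (Function.uncurry W) ∧ (∀ x y, 0 ≤ W x y) ∧ (∀ x y, W x y = W y x) ∧
    ∃ M : ℝ, ∀ x y, W x y ≤ M

/-- The Bernoulli measure on `Bool` with success probability `p`. -/
def bern (p : ℝ) : Measure Bool :=
  ENNReal.ofReal p • Measure.dirac true + ENNReal.ofReal (1 - p) • Measure.dirac false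

/-- The law of the random graph in which each pair `{v, w}` is an edge independently
with probability `min (p * β v w) 1`; a point of the sample space records for each
unordered pair whether it is an edge. -/
def percMeasure {V : Type*} [Fintype V] [DecidableEq V] (β : V → V → ℝ) (p : ℝ) :
    Measure (Sym2 V → Bool) :=
  Measure.pi fun e => bern (min (p * sym2Val β e) 1)

/-- The simple graph determined by a point of the sample space. -/
def graphOf {V : Type*} (ω : Sym2 V → Bool) : SimpleGraph V :=
  SimpleGraph.fromRel fun i j => ω s(i, j)

/-- The number of vertices of the component of `v` in `G`. -/
def compSize {V : Type*} (G : SimpleGraph V) (v : V) : ℕ := {w | G.Reachable v w}.ncard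

/-- The number of vertices of the largest component of `G`. -/
def C1 {V : Type*} [Fintype V] (G : SimpleGraph V) : ℕ :=
  Finset.univ.sup fun v => compSize G v

/-- The number of vertices of the second largest component of `G` (zero if `G` is
connected): the largest value of `min (|C_v|, |C_w|)` over vertices `v`, `w` lying in
distinct components. -/
def C2 {V : Type*} (G : SimpleGraph V) : ℕ :=
  sSup {m | ∃ v w : V, ¬G.Reachable v w ∧ m = min (compSize G v) (compSize G w)}

/-- The operator `T_W` with kernel `W` applied to `f`. -/
def applyT (W : ℝ → ℝ → ℝ) (f : ℝ → ℝ) (x : ℝ) : ℝ := ∫ y in I01, W x y * f y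

/-- The `L²[0,1]` norm of a function. -/
def l2norm (f : ℝ → ℝ) : ℝ := Real.sqrt (∫ x in I01, f x ^ 2)

/-- The `L²`-operator norm `‖T_W‖` of the integral operator with kernel `W`. -/
def opNorm (W : ℝ → ℝ → ℝ) : ℝ :=
  sSup {r | ∃ f : ℝ → ℝ, Measurable f ∧
    MeasureTheory.IntegrableOn (fun x => f x ^ 2) I01 ∧
    l2norm f ≤ 1 ∧ r = l2norm (applyT W f)}

/-- The survival probability `ρ(W)` of the multitype Poisson branching process with
kernel `W`: the supremum of `∫ f` over measurable `f : [0,1] → [0,1]` satisfying the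
functional equation `f(x) = 1 - exp(-∫ W(x,y) f(y) dy)` almost everywhere. -/
def survival (W : ℝ → ℝ → ℝ) : ℝ :=
  sSup {r | ∃ f : ℝ → ℝ, Measurable f ∧ (∀ x, f x ∈ Set.Icc (0 : ℝ) 1) ∧
    (∀ᵐ x ∂volume.restrict I01, f x = 1 - Real.exp (-∫ y in I01, W x y * f y)) ∧
    r = ∫ x in I01, f x}

/-- A graphon `W` is irreducible if there is no measurable `A ⊆ [0,1]` with
`0 < μ(A) < 1` such that `W = 0` a.e. on `A × ([0,1] \ A)`. -/
def Irreducible (W : ℝ → ℝ → ℝ) : Prop :=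
  ¬∃ A : Set ℝ, MeasurableSet A ∧ A ⊆ I01 ∧ 0 < volume A ∧ volume A < 1 ∧
    ∀ᵐ p : ℝ × ℝ, p.1 ∈ A → p.2 ∈ I01 \ A → W p.1 p.2 = 0

end Percolation
namespace Percolation
def pot {V : Type*} [Fintype V] [DecidableEq V] (q : Sym2 V → ℝ) (l : ℝ) (f : V → ℝ) (A : Finset V)
    (D : Finset (Sym2 V)) : ℝ :=
  ∑ a ∈ A, (l + ∑ u, if u ∉ A ∧ s(a,u) ∈ D then q s(a,u) * (Real.exp (f u) - 1) else 0)

def cl {V : Type*} (A : Finset V) (D : Finset (Sym2 V)) (ω : Sym2 V → Bool) : Set V :=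
  {w | ∃ a ∈ A, Relation.ReflTransGen (fun i j => s(i,j) ∈ D ∧ ω s(i,j) = true) a w}

lemma cl_sub {V : Type*} (A : Finset V) (D : Finset (Sym2 V)) (ω : Sym2 V → Bool) (S : Set V)
    (h0 : ∀ a ∈ A, a ∈ S) (h1 : ∀ i j, i ∈ S → s(i,j) ∈ D → ω s(i,j) = true → j ∈ S) :
    cl A D ω ⊆ S := by
  rintro w ⟨a, ha, h⟩
  induction h with
  | refl => exact h0 a ha
  | tail _ h2 ih => exact h1 _ _ ih h2.1 h2.2

lemma cl_step {V : Type*} {A : Finset V} {D : Finset (Sym2 V)} {ω : Sym2 V → Bool} {i j : V}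
    (hi : i ∈ cl A D ω) (h : s(i,j) ∈ D) (h' : ω s(i,j) = true) : j ∈ cl A D ω := by
  obtain ⟨a, ha, h2⟩ := hi
  exact ⟨a, ha, h2.tail ⟨h, h'⟩⟩

lemma cl_base {V : Type*} {A : Finset V} {D : Finset (Sym2 V)} {ω : Sym2 V → Bool} {i : V}
    (hi : i ∈ A) : i ∈ cl A D ω := ⟨i, hi, .refl⟩

lemma cl_true {V : Type*} [DecidableEq V] (A : Finset V) (D : Finset (Sym2 V)) (ω : Sym2 V → Bool) (a u : V)
    (ha : a ∈ A) (hD : s(a,u) ∉ D) :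
    cl A (insert s(a,u) D) (Function.update ω s(a,u) true) ⊆ cl (insert u A) D ω := by
  apply cl_sub
  · intro b hb; exact cl_base (Finset.mem_insert_of_mem hb)
  · intro i j hi hij ho
    by_cases he : s(i,j) = s(a,u)
    · have : j = a ∨ j = u := by
        have : j ∈ s(a,u) := by rw [← he]; simp
        simpa using this
      rcases this with rfl | rfl
      · exact cl_base (Finset.mem_insert_of_mem ha)
      · exact cl_base (Finset.mem_insert_self _ _)
    · rw [Function.update_of_ne he] at ho
      exact cl_step hi (Finset.mem_of_mem_insert_of_ne hij he) ho

lemma cl_false {V : Type*} [DecidableEq V] (A : Finset V) (D : Finset (Sym2 V)) (ω : Sym2 V → Bool) (e : Sym2 V) :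
    cl A (insert e D) (Function.update ω e false) ⊆ cl A D ω := by
  apply cl_sub
  · intro b hb; exact cl_base hb
  · intro i j hi hij ho
    by_cases he : s(i,j) = e
    · subst he; simp at ho
    · rw [Function.update_of_ne he] at ho
      exact cl_step hi (Finset.mem_of_mem_insert_of_ne hij he) ho

lemma pot_edge {V : Type*} [Fintype V] [DecidableEq V] (q : Sym2 V → ℝ) (l : ℝ) (f : V → ℝ)
    (hq : ∀ e, 0 ≤ q e) (hf : ∀ v, 0 ≤ f v) (A : Finset V)
    (D : Finset (Sym2 V)) (a u : V) (ha : a ∈ A) (hu : u ∉ A) (hD : s(a,u) ∉ D) :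
    pot q l f A D + q s(a,u) * (Real.exp (f u) - 1) ≤ pot q l f A (insert s(a,u) D) := by
  have key : ∀ b v, 0 ≤ q s(b,v) * (Real.exp (f v) - 1) := fun b v =>
    mul_nonneg (hq _) (by have := Real.one_le_exp (hf v); linarith)
  unfold pot
  rw [← Finset.add_sum_erase _ _ ha, ← Finset.add_sum_erase A (fun a_1 => (l + ∑ u_1, if u_1 ∉ A ∧ s(a_1,u_1) ∈ insert s(a,u) D then q s(a_1,u_1) * (Real.exp (f u_1) - 1) else 0)) ha]
  have h1 : ∀ b, (∑ v, if v ∉ A ∧ s(b,v) ∈ D then q s(b,v) * (Real.exp (f v) - 1) else 0)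
      ≤ ∑ v, if v ∉ A ∧ s(b,v) ∈ insert s(a,u) D then q s(b,v) * (Real.exp (f v) - 1) else 0 := by
    intro b
    refine Finset.sum_le_sum fun v _ => ?_
    have := key b v
    simp only [Finset.mem_insert]
    split_ifs <;> first | tauto | rfl | assumption
  have h2 : (∑ v, if v ∉ A ∧ s(a,v) ∈ D then q s(a,v) * (Real.exp (f v) - 1) else 0)
      + q s(a,u) * (Real.exp (f u) - 1)
      ≤ ∑ v, if v ∉ A ∧ s(a,v) ∈ insert s(a,u) D then q s(a,v) * (Real.exp (f v) - 1) else 0 := by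
    have : q s(a,u) * (Real.exp (f u) - 1)
      = ∑ v, if v = u then q s(a,v) * (Real.exp (f v) - 1) else 0 := by simp
    rw [this, ← Finset.sum_add_distrib]
    refine Finset.sum_le_sum fun v _ => ?_
    have := key a v
    by_cases hv : v = u
    · subst hv; simp [hu, hD]
    · simp only [Finset.mem_insert, hv, if_false, add_zero]
      split_ifs <;> first | tauto | rfl | assumption
  have h3 : ∑ b ∈ A.erase a, (l + ∑ v, if v ∉ A ∧ s(b,v) ∈ D then q s(b,v) * (Real.exp (f v) - 1) else 0)
      ≤ ∑ b ∈ A.erase a, (l + ∑ v, if v ∉ A ∧ s(b,v) ∈ insert s(a,u) D then q s(b,v) * (Real.exp (f v) - 1) else 0) :=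
    Finset.sum_le_sum fun b _ => by linarith [h1 b]
  linarith

lemma pot_vertex {V : Type*} [Fintype V] [DecidableEq V] (q : Sym2 V → ℝ) (l : ℝ) (f : V → ℝ)
    (hq : ∀ e, 0 ≤ q e) (hf : ∀ v, 0 ≤ f v)
    (hlf : ∀ a, l + ∑ u, q s(a,u) * (Real.exp (f u) - 1) ≤ f a) (A : Finset V)
    (D : Finset (Sym2 V)) (u : V) (hu : u ∉ A) :
    pot q l f (insert u A) D ≤ pot q l f A D + f u := by
  have key : ∀ b v, 0 ≤ q s(b,v) * (Real.exp (f v) - 1) := fun b v =>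
    mul_nonneg (hq _) (by have := Real.one_le_exp (hf v); linarith)
  unfold pot
  rw [Finset.sum_insert hu, add_comm]
  apply add_le_add
  · refine Finset.sum_le_sum fun b _ => ?_
    gcongr with v
    have := key b v
    simp only [Finset.mem_insert]
    split_ifs <;> first | tauto | rfl | assumption
  · refine le_trans ?_ (hlf u)
    gcongr with v
    have := key u v
    split_ifs <;> first | tauto | rfl | assumption

instance (p : ℝ) : IsFiniteMeasure (bern p) := by
  unfold bern
  have : ∀ x : ℝ, IsFiniteMeasure (ENNReal.ofReal x • (Measure.dirac true : Measure Bool)) :=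
    fun x => Measure.smul_finite _ ENNReal.ofReal_ne_top
  have : ∀ x : ℝ, IsFiniteMeasure (ENNReal.ofReal x • (Measure.dirac false : Measure Bool)) :=
    fun x => Measure.smul_finite _ ENNReal.ofReal_ne_top
  infer_instance

lemma bern_prob {p : ℝ} (h0 : 0 ≤ p) (h1 : p ≤ 1) : IsProbabilityMeasure (bern p) := by
  constructor
  unfold bern
  simp only [Measure.coe_add, Measure.coe_smul, Pi.add_apply, Pi.smul_apply, measure_univ, smul_eq_mul, mul_one]
  rw [← ENNReal.ofReal_add h0 (by linarith)]; simp

lemma lintegral_bern (p : ℝ) (F : Bool → ENNReal) : ∫⁻ b, F b ∂(bern p)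
    = ENNReal.ofReal p * F true + ENNReal.ofReal (1 - p) * F false := by
  unfold bern
  rw [lintegral_add_measure, lintegral_smul_measure, lintegral_smul_measure]
  simp

lemma meas_all {V : Type*} [Finite V] (F : (V → Bool) → ENNReal) : Measurable F :=
  measurable_of_finite F

lemma main_ind {V : Type*} [Fintype V] [DecidableEq V] (q : Sym2 V → ℝ) (l : ℝ) (f : V → ℝ)
    (hq : ∀ e, 0 ≤ q e) (hq1 : ∀ e, q e ≤ 1) (hl : 0 ≤ l) (hf : ∀ v, 0 ≤ f v)
    (hlf : ∀ a, l + ∑ u, q s(a,u) * (Real.exp (f u) - 1) ≤ f a) (N : ℕ) :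
    ∀ (A : Finset V) (D : Finset (Sym2 V)) (_ : D.card = N) (x : Sym2 V → Bool),
    lmarginal (fun e => bern (q e)) D
      (fun ω => ENNReal.ofReal (Real.exp (l * (cl A D ω).ncard))) x
      ≤ ENNReal.ofReal (Real.exp (pot q l f A D)) := by
  have key : ∀ b v, 0 ≤ q s(b,v) * (Real.exp (f v) - 1) := fun b v =>
    mul_nonneg (hq _) (by have := Real.one_le_exp (hf v); linarith)
  have : ∀ e, IsProbabilityMeasure (bern (q e)) := fun e => bern_prob (hq e) (hq1 e)
  induction N with
  | zero => 
    intro A D hD x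
    rw [Finset.card_eq_zero] at hD
    subst hD
    rw [lmarginal_empty]
    apply ENNReal.ofReal_le_ofReal
    apply Real.exp_le_exp.2
    have : cl A ∅ x ⊆ A := cl_sub _ _ _ _ (by simp) (by simp)
    have h2 := Set.ncard_le_ncard this
    rw [Set.ncard_coe_finset] at h2
    simp only [pot, Finset.notMem_empty, and_false, if_false, Finset.sum_const_zero, add_zero, Finset.sum_const, nsmul_eq_mul]
    rw [mul_comm]
    gcongr
  | succ N ih =>
    intro A D hD x
    by_cases hcr : ∃ a ∈ A, ∃ u, u ∉ A ∧ s(a,u) ∈ D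
    · obtain ⟨a, ha, u, hu, haD⟩ := hcr
      obtain ⟨D', hD', rfl⟩ : ∃ D', s(a,u) ∉ D' ∧ D = insert s(a,u) D' :=
        ⟨D.erase s(a,u), Finset.notMem_erase _ _, (Finset.insert_erase haD).symm⟩
      have hc : D'.card = N := by
        rw [Finset.card_insert_of_notMem hD'] at hD; omega
      rw [lmarginal_insert' _ (meas_all _) hD']
      have hmono : lmarginal (fun e => bern (q e)) D' (fun x => ∫⁻ (xi : Bool), (fun ω => ENNReal.ofReal (Real.exp (l * (cl A (insert s(a,u) D') ω).ncard)))
            (Function.update x s(a,u) xi) ∂(bern (q s(a,u)))) x ≤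
          lmarginal (fun e => bern (q e)) D' (fun ω => ENNReal.ofReal (q s(a,u)) * ENNReal.ofReal (Real.exp (l * (cl (insert u A) D' ω).ncard)) + ENNReal.ofReal (1 - q s(a,u)) * ENNReal.ofReal (Real.exp (l * (cl A D' ω).ncard))) x := by
        refine lmarginal_mono (fun ω => ?_) x
        simp only
        rw [lintegral_bern]
        gcongr
        · exact Set.toFinite _
        · exact cl_true A D' ω a u ha hD'
        · exact Set.toFinite _
        · exact cl_false A D' ω _
      refine hmono.trans ?_
      have e1 := ih (insert u A) D' hc x
      have e2 := ih A D' hc x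
      unfold lmarginal at e1 e2 ⊢
      rw [lintegral_add_left (meas_all _), lintegral_const_mul _ (meas_all _), lintegral_const_mul _ (meas_all _)]
      refine (add_le_add (mul_le_mul_right e1 _) (mul_le_mul_right e2 _)).trans ?_
      rw [← ENNReal.ofReal_mul (hq _), ← ENNReal.ofReal_mul (by linarith [hq1 s(a,u)]), ← ENNReal.ofReal_add]
      rotate_left
      · exact mul_nonneg (hq _) (Real.exp_pos _).le
      · exact mul_nonneg (by linarith [hq1 s(a,u)]) (Real.exp_pos _).le
      apply ENNReal.ofReal_le_ofReal
      have p1 := pot_edge q l f hq hf A D' a u ha hu hD'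
      have p2 := pot_vertex q l f hq hf hlf A D' u hu
      calc q s(a,u) * Real.exp (pot q l f (insert u A) D') + (1 - q s(a,u)) * Real.exp (pot q l f A D')
          ≤ q s(a,u) * Real.exp (pot q l f A D' + f u) + (1 - q s(a,u)) * Real.exp (pot q l f A D') := by
            have := mul_le_mul_of_nonneg_left (Real.exp_le_exp.2 p2) (hq s(a,u))
            linarith
        _ = Real.exp (pot q l f A D') * (q s(a,u) * (Real.exp (f u) - 1) + 1) := by
            rw [Real.exp_add]; ring
        _ ≤ Real.exp (pot q l f A D') * Real.exp (q s(a,u) * (Real.exp (f u) - 1)) := by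
            gcongr; exact Real.add_one_le_exp _
        _ ≤ _ := by rw [← Real.exp_add]; exact Real.exp_le_exp.2 p1
    · push Not at hcr
      have hsub : ∀ ω, cl A D ω ⊆ A := fun ω => cl_sub _ _ _ _ (by simp) (by
        intro i j hi hij _
        by_contra hj
        exact hcr i hi j hj hij)
      have hb : ∀ ω, ENNReal.ofReal (Real.exp (l * (cl A D ω).ncard)) ≤ ENNReal.ofReal (Real.exp (pot q l f A D)) := by
        intro ω
        apply ENNReal.ofReal_le_ofReal
        apply Real.exp_le_exp.2
        have h2 := Set.ncard_le_ncard (hsub ω)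
        rw [Set.ncard_coe_finset] at h2
        have : l * A.card ≤ pot q l f A D := by
          unfold pot
          rw [mul_comm, ← nsmul_eq_mul, ← Finset.sum_const]
          refine Finset.sum_le_sum fun b _ => ?_
          have : 0 ≤ ∑ v, if v ∉ A ∧ s(b,v) ∈ D then q s(b,v) * (Real.exp (f v) - 1) else 0 :=
            Finset.sum_nonneg fun v _ => by split_ifs; exacts [key b v, le_rfl]
          linarith
        refine le_trans ?_ this
        gcongr
      refine (lmarginal_mono (g := fun _ => ENNReal.ofReal (Real.exp (pot q l f A D))) (fun ω => hb ω) x).trans ?_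
      unfold lmarginal
      rw [lintegral_const]
      simp

lemma compSize_le {V : Type*} [Fintype V] (ω : Sym2 V → Bool) (v : V) :
    compSize (graphOf ω) v ≤ (cl {v} Finset.univ ω).ncard := by
  apply Set.ncard_le_ncard _ (Set.toFinite _)
  intro w hw
  refine ⟨v, by simp, ?_⟩
  have := (SimpleGraph.reachable_iff_reflTransGen v w).1 hw
  refine Relation.ReflTransGen.mono ?_ _ _ this
  intro a b hab
  simp only [graphOf, SimpleGraph.fromRel_adj] at hab
  rcases hab.2 with h | h
  · simpa using h
  · rw [Sym2.eq_swap] at h; simpa using h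

lemma comp_exp {V : Type*} [Fintype V] [DecidableEq V] (q : Sym2 V → ℝ) (l : ℝ) (f : V → ℝ)
    (hq : ∀ e, 0 ≤ q e) (hq1 : ∀ e, q e ≤ 1) (hl : 0 ≤ l) (hf : ∀ v, 0 ≤ f v)
    (hlf : ∀ a, l + ∑ u, q s(a,u) * (Real.exp (f u) - 1) ≤ f a) (v : V) :
    ∫⁻ ω, ENNReal.ofReal (Real.exp (l * compSize (graphOf ω) v)) ∂(Measure.pi fun e => bern (q e))
      ≤ ENNReal.ofReal (Real.exp (f v)) := by
  have key : ∀ b v, 0 ≤ q s(b,v) * (Real.exp (f v) - 1) := fun b v =>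
    mul_nonneg (hq _) (by have := Real.one_le_exp (hf v); linarith)
  have h := main_ind q l f hq hq1 hl hf hlf _ {v} Finset.univ rfl (fun _ => true)
  rw [← lintegral_eq_lmarginal_univ] at h
  refine (lintegral_mono fun ω => ?_).trans (h.trans ?_)
  · apply ENNReal.ofReal_le_ofReal
    have := compSize_le ω v
    gcongr
  · apply ENNReal.ofReal_le_ofReal
    apply Real.exp_le_exp.2
    refine le_trans ?_ (hlf v)
    simp only [pot, Finset.sum_singleton]
    gcongr with u
    have := key v u
    split_ifs <;> first | rfl | assumption

lemma comp_tail {V : Type*} [Fintype V] [DecidableEq V] (q : Sym2 V → ℝ) (l : ℝ) (f : V → ℝ)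
    (hq : ∀ e, 0 ≤ q e) (hq1 : ∀ e, q e ≤ 1) (hl : 0 ≤ l) (hf : ∀ v, 0 ≤ f v)
    (hlf : ∀ a, l + ∑ u, q s(a,u) * (Real.exp (f u) - 1) ≤ f a) (m F : ℝ) (hm : 0 ≤ m) (hF : ∀ v, f v ≤ F) :
    (Measure.pi fun e => bern (q e)) {ω | m < (C1 (graphOf ω) : ℝ)}
      ≤ (Fintype.card V : ENNReal) * ENNReal.ofReal (Real.exp (F - l * m)) := by
  have h1 : ∀ v, (Measure.pi fun e => bern (q e)) {ω | m < (compSize (graphOf ω) v : ℝ)}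
      ≤ ENNReal.ofReal (Real.exp (F - l * m)) := by
    intro v
    have h2 := mul_meas_ge_le_lintegral (μ := Measure.pi fun e => bern (q e)) (meas_all (fun ω => ENNReal.ofReal (Real.exp (l * compSize (graphOf ω) v)))) (ENNReal.ofReal (Real.exp (l * m)))
    have h3 := h2.trans (comp_exp q l f hq hq1 hl hf hlf v)
    have h4 : (Measure.pi fun e => bern (q e)) {ω | m < (compSize (graphOf ω) v : ℝ)} ≤
      (Measure.pi fun e => bern (q e)) {ω | ENNReal.ofReal (Real.exp (l * m)) ≤ ENNReal.ofReal (Real.exp (l * compSize (graphOf ω) v))} := by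
      apply measure_mono
      intro ω hω
      apply ENNReal.ofReal_le_ofReal
      have := le_of_lt hω.out
      gcongr
    refine h4.trans ?_
    have h5 : ENNReal.ofReal (Real.exp (F - l * m)) = ENNReal.ofReal (Real.exp F) / ENNReal.ofReal (Real.exp (l * m)) := by
      rw [Real.exp_sub, ENNReal.ofReal_div_of_pos (Real.exp_pos _)]
    rw [h5, ENNReal.le_div_iff_mul_le (by left; simp [Real.exp_pos]) (by left; simp), mul_comm]
    exact h3.trans (ENNReal.ofReal_le_ofReal (Real.exp_le_exp.2 (hF v)))
  have h6 : {ω : Sym2 V → Bool | m < (C1 (graphOf ω) : ℝ)} ⊆ (⋃ v, {ω | m < (compSize (graphOf ω) v : ℝ)}) := by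
    intro ω hω
    have h7 := hω.out
    unfold C1 at h7
    by_cases hV : Nonempty V
    · obtain ⟨v, _, hv⟩ := Finset.exists_mem_eq_sup (Finset.univ : Finset V) Finset.univ_nonempty (fun v => compSize (graphOf ω) v)
      simp only [Set.mem_iUnion]
      refine ⟨v, ?_⟩
      rw [hv] at h7
      exact h7
    · rw [not_nonempty_iff] at hV
      simp at h7
      linarith
  refine (measure_mono h6).trans ((measure_iUnion_fintype_le _ _).trans ?_)
  refine (Finset.sum_le_sum fun v _ => h1 v).trans ?_
  simp
end Percolation
namespace Percolation
lemma edgeProd_path {k : ℕ} (f : Fin (k+1) → Fin (k+1) → ℝ) (hf : ∀ i j, f i j = f j i) :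
    edgeProd (SimpleGraph.pathGraph (k+1)) f = ∏ i : Fin k, f i.castSucc i.succ := by
  classical
  unfold edgeProd
  have h : ∀ a b, sym2Val f s(a,b) = f a b := by
    intro a b
    simp only [sym2Val, Sym2.lift_mk]
    rw [hf b a]; ring
  symm
  refine Finset.prod_bij (fun i _ => s(i.castSucc, i.succ)) ?_ ?_ ?_ ?_
  · intro i _
    simp [SimpleGraph.pathGraph_adj]
  · intro i _ j _ hij
    simp only [Sym2.eq_iff, Fin.ext_iff, Fin.val_castSucc, Fin.val_succ] at hij
    ext; omega
  · intro e he
    induction e using Sym2.ind with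
    | _ a b =>
      rw [SimpleGraph.mem_edgeFinset, SimpleGraph.mem_edgeSet, SimpleGraph.pathGraph_adj] at he
      rcases he with he | he
      · refine ⟨⟨a, by omega⟩, Finset.mem_univ _, ?_⟩
        simp only [Sym2.eq_iff, Fin.ext_iff, Fin.val_castSucc, Fin.val_succ]; grind
      · refine ⟨⟨b, by omega⟩, Finset.mem_univ _, ?_⟩
        simp only [Sym2.eq_iff, Fin.ext_iff, Fin.val_castSucc, Fin.val_succ]; grind
  · intro i _
    rw [h]

def dT {n : ℕ} (β : Fin n → Fin n → ℝ) (g : Fin n → ℝ) (i : Fin n) : ℝ := ∑ j, β i j / n * g j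

lemma path_sum {n : ℕ} (β : Fin n → Fin n → ℝ) (hβ : ∀ i j, β i j = β j i) (k : ℕ) :
    ∀ g : Fin n → ℝ, (∑ v : Fin (k+1) → Fin n, g (v 0) * ∏ i : Fin k, β (v i.castSucc) (v i.succ)) / (n:ℝ)^(k+1)
      = (∑ i, (dT β)^[k] g i) / n := by
  induction k with
  | zero =>
    intro g
    simp only [Finset.univ_eq_empty, Finset.prod_empty, mul_one, zero_add, pow_one, Function.iterate_zero, id]
    congr 1
    exact Fintype.sum_equiv (Equiv.funUnique (Fin 1) (Fin n)) _ _ (fun v => rfl)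
  | succ k ih =>
    intro g
    rw [Function.iterate_succ_apply, ← ih (dT β g)]
    rw [← Equiv.sum_comp (Fin.consEquiv (fun _ => Fin n)), Fintype.sum_prod_type_right]
    rw [pow_succ (n:ℝ) (k+1), mul_comm, ← div_div, Finset.sum_div]
    congr 1
    refine Finset.sum_congr rfl fun v _ => ?_
    unfold dT
    rw [Finset.sum_div, Finset.sum_mul]
    refine Finset.sum_congr rfl fun x _ => ?_
    simp only [Fin.consEquiv_apply, Fin.prod_univ_succ (n := k), Fin.cons_zero, Fin.cons_succ, Fin.castSucc_zero, ← Fin.succ_castSucc]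
    rw [hβ x (v 0)]
    ring

lemma homDensityG_path {n : ℕ} (β : Fin n → Fin n → ℝ) (hβ : ∀ i j, β i j = β j i) (k : ℕ) :
    homDensityG β (SimpleGraph.pathGraph (k+1)) = (∑ i, (dT β)^[k] (fun _ => 1) i) / n := by
  rw [← path_sum β hβ k]
  unfold homDensityG
  congr 1
  refine Finset.sum_congr rfl fun v _ => ?_
  rw [edgeProd_path _ (fun i j => hβ _ _), one_mul]

abbrev mu01 : Measure ℝ := volume.restrict I01

instance : IsProbabilityMeasure mu01 := ⟨by simp [mu01, I01]⟩

lemma applyT_meas {W : ℝ → ℝ → ℝ} (hW : Measurable (Function.uncurry W)) {g : ℝ → ℝ} (hg : Measurable g) :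
    Measurable (applyT W g) := by
  unfold applyT
  have : StronglyMeasurable (Function.uncurry fun x y => W x y * g y) :=
    (hW.mul (hg.comp measurable_snd)).stronglyMeasurable
  exact (this.integral_prod_right (ν := mu01)).measurable

lemma applyT_bdd {W : ℝ → ℝ → ℝ} {M C : ℝ} (hM : ∀ x y, |W x y| ≤ M) {g : ℝ → ℝ} (hg : ∀ x, |g x| ≤ C) (x : ℝ) :
    |applyT W g x| ≤ M * C := by
  have h := norm_integral_le_of_norm_le_const (μ := mu01) (f := fun y => W x y * g y) (C := M * C)
    (Eventually.of_forall fun y => by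
      rw [Real.norm_eq_abs, abs_mul]
      exact mul_le_mul (hM _ _) (hg _) (abs_nonneg _) ((abs_nonneg _).trans (hM x y)))
  rw [probReal_univ, mul_one] at h
  exact h

lemma path_int {W : ℝ → ℝ → ℝ} {M : ℝ} (hW : Measurable (Function.uncurry W)) 
    (hM : ∀ x y, |W x y| ≤ M) (hs : ∀ x y, W x y = W y x) (k : ℕ) :
    ∀ (g : ℝ → ℝ) (C : ℝ), Measurable g → (∀ x, |g x| ≤ C) → 
      ∫ x : Fin (k+1) → ℝ, g (x 0) * ∏ i : Fin k, W (x i.castSucc) (x i.succ) ∂(Measure.pi fun _ => mu01)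
      = ∫ x, (applyT W)^[k] g x ∂mu01 := by
  induction k with
  | zero =>
    intro g C hg hC
    simp only [Finset.univ_eq_empty, Finset.prod_empty, mul_one, Function.iterate_zero, id]
    exact (measurePreserving_funUnique mu01 (Fin 1)).integral_comp' (f := MeasurableEquiv.funUnique (Fin 1) ℝ) g
  | succ k ih =>
    intro g C hg hC
    rw [Function.iterate_succ_apply, ← ih (applyT W g) (M * C) (applyT_meas hW hg) (applyT_bdd hM hC)]
    have hmp := (measurePreserving_piFinSuccAbove (fun _ : Fin (k+2) => mu01) 0).symm
    rw [← hmp.integral_comp', integral_prod_symm]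
    · refine integral_congr_ae (Eventually.of_forall fun v => ?_)
      simp only [applyT]
      rw [← integral_mul_const]
      refine integral_congr_ae (Eventually.of_forall fun x => ?_)
      have hc : (MeasurableEquiv.piFinSuccAbove (fun _ : Fin (k+2) => ℝ) 0).symm (x, v) = (Fin.cons x v : Fin (k+2) → ℝ) := by
        exact Fin.insertNth_zero' (β := ℝ) x v
      simp only [hc, Fin.prod_univ_succ (n := k), Fin.cons_zero, Fin.cons_succ, Fin.castSucc_zero, ← Fin.succ_castSucc]
      rw [hs x (v 0)]
      ring
    · have hF : Measurable (fun x : Fin (k+2) → ℝ => g (x 0) * ∏ i : Fin (k+1), W (x i.castSucc) (x i.succ)) := by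
        refine (hg.comp (measurable_pi_apply 0)).mul (Finset.measurable_prod _ fun i _ => ?_)
        have hp : Measurable (fun x : Fin (k+2) → ℝ => (x i.castSucc, x i.succ)) :=
          (measurable_pi_apply i.castSucc).prodMk (measurable_pi_apply i.succ)
        exact hW.comp hp
      refine Integrable.of_bound (hF.comp (MeasurableEquiv.measurable _)).aestronglyMeasurable (C * M^(k+1)) (Eventually.of_forall fun p => ?_)
      rw [Real.norm_eq_abs, abs_mul, Finset.abs_prod]
      refine mul_le_mul (hC _) ?_ (Finset.prod_nonneg fun _ _ => abs_nonneg _) ((abs_nonneg _).trans (hC 0))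
      refine (Finset.prod_le_prod (fun _ _ => abs_nonneg _) (fun _ _ => hM _ _)).trans ?_
      simp

lemma homDensityW_path {W : ℝ → ℝ → ℝ} {M : ℝ} (hW : Measurable (Function.uncurry W)) 
    (hM : ∀ x y, |W x y| ≤ M) (hs : ∀ x y, W x y = W y x) (k : ℕ) :
    homDensityW W (SimpleGraph.pathGraph (k+1)) = ∫ x, (applyT W)^[k] (fun _ => 1) x ∂mu01 := by
  rw [← path_int hW hM hs k (fun _ => 1) 1 measurable_const (by simp)]
  unfold homDensityW
  rw [volume_pi, Measure.restrict_pi_pi]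
  refine integral_congr_ae (Eventually.of_forall fun x => ?_)
  simp only [one_mul]
  rw [edgeProd_path _ (fun i j => hs _ _)]

lemma opNorm_le {W : ℝ → ℝ → ℝ} {M : ℝ} (hM : ∀ x y, |W x y| ≤ M) {f : ℝ → ℝ} (hf : Measurable f)
    (hi : IntegrableOn (fun x => f x ^ 2) I01) (h1 : l2norm f ≤ 1) : l2norm (applyT W f) ≤ opNorm W := by
  refine le_csSup ⟨M, ?_⟩ ⟨f, hf, hi, h1, rfl⟩
  rintro r ⟨f, hf, hi, h1, rfl⟩
  have hM0 : 0 ≤ M := (abs_nonneg _).trans (hM 0 0)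
  have h2 : ∫ x in I01, f x ^ 2 ≤ 1 := by
    unfold l2norm at h1
    simpa using (Real.sqrt_le_left zero_le_one).1 h1
  have h3 : ∀ x, |applyT W f x| ≤ M := by
    intro x
    have h4 := norm_integral_le_of_norm_le (μ := mu01) (f := fun y => W x y * f y) (g := fun y => M * ((f y ^ 2 + 1)/2))
      (((hi.add (integrable_const (1:ℝ))).div_const 2).const_mul M)
      (Eventually.of_forall fun y => by
        rw [Real.norm_eq_abs, abs_mul]
        refine mul_le_mul (hM _ _) ?_ (abs_nonneg _) hM0
        nlinarith [sq_nonneg (|f y| - 1), sq_abs (f y)])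
    rw [integral_const_mul, integral_div, integral_add hi (integrable_const _)] at h4
    simp only [integral_const, probReal_univ, smul_eq_mul, mul_one] at h4
    refine h4.trans ?_
    have : M * ((∫ x in I01, f x ^ 2) + 1) / 2 ≤ M * (1 + 1) / 2 := by gcongr
    linarith
  unfold l2norm
  apply Real.sqrt_le_iff.2 ⟨hM0, ?_⟩
  have h5 := norm_integral_le_of_norm_le_const (μ := mu01) (f := fun x => applyT W f x ^ 2) (C := M^2)
    (Eventually.of_forall fun x => by
      rw [Real.norm_eq_abs, abs_pow]
      exact pow_le_pow_left₀ (abs_nonneg _) (h3 x) 2)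
  simp only [probReal_univ, mul_one] at h5
  exact (le_abs_self _).trans h5

lemma opNorm_nonneg (W : ℝ → ℝ → ℝ) : 0 ≤ opNorm W := by
  apply Real.sSup_nonneg
  rintro r ⟨f, _, _, _, rfl⟩
  exact Real.sqrt_nonneg _

lemma sq_int {g : ℝ → ℝ} {C : ℝ} (hg : Measurable g) (hC : ∀ x, |g x| ≤ C) : Integrable (fun x => g x ^ 2) mu01 :=
  Integrable.of_bound (hg.pow_const 2).aestronglyMeasurable (C^2) (Eventually.of_forall fun x => by
      rw [Real.norm_eq_abs, abs_pow]
      exact pow_le_pow_left₀ (abs_nonneg _) (hC x) 2)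

lemma iter_bound {W : ℝ → ℝ → ℝ} {M : ℝ} (hW : Measurable (Function.uncurry W)) 
    (hM : ∀ x y, |W x y| ≤ M) {r : ℝ} (hr : opNorm W ≤ r) (hr0 : 0 < r) (k : ℕ) :
    Measurable ((applyT W)^[k] (fun _ => 1)) ∧ (∀ x, |(applyT W)^[k] (fun _ => 1) x| ≤ M^k) ∧
      l2norm ((applyT W)^[k] (fun _ => 1)) ≤ r^k := by
  induction k with
  | zero => simp [l2norm, measurable_const]
  | succ k ih =>
    obtain ⟨h1, h2, h3⟩ := ih
    simp only [Function.iterate_succ_apply']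
    set g := (applyT W)^[k] (fun _ => 1)
    refine ⟨applyT_meas hW h1, fun x => (applyT_bdd hM h2 x).trans (by rw [pow_succ']), ?_⟩
    have hrk : 0 < r^k := pow_pos hr0 k
    have hscale : ∀ f : ℝ → ℝ, l2norm (fun x => f x / r^k) = l2norm f / r^k := by
      intro f
      unfold l2norm
      simp only [div_pow]
      rw [integral_div, Real.sqrt_div' _ (by positivity), Real.sqrt_sq hrk.le]
    have h4 := opNorm_le hM (f := fun x => g x / r^k) (h1.div_const _) 
      (by simp only [div_pow]; exact (sq_int h1 h2).div_const _) (by rw [hscale, div_le_one hrk]; exact h3)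
    have h5 : applyT W (fun x => g x / r^k) = fun x => applyT W g x / r^k := by
      funext x
      unfold applyT
      rw [← integral_div]
      simp only [mul_div_assoc]
    rw [h5, hscale, div_le_iff₀ hrk] at h4
    calc _ ≤ _ := h4
      _ ≤ r * r^k := by gcongr
      _ = _ := by ring

lemma density_bound {W : ℝ → ℝ → ℝ} {M : ℝ} (hW : Measurable (Function.uncurry W)) 
    (hM : ∀ x y, |W x y| ≤ M) (hs : ∀ x y, W x y = W y x) {r : ℝ} (hr : opNorm W ≤ r) (hr0 : 0 < r) (k : ℕ) :
    homDensityW W (SimpleGraph.pathGraph (k+1)) ≤ r^k := by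
  rw [homDensityW_path hW hM hs]
  obtain ⟨h1, h2, h3⟩ := iter_bound hW hM hr hr0 k
  set g := (applyT W)^[k] (fun _ => 1)
  have hrk : 0 < r^k := pow_pos hr0 k
  have h4 : ∫ x in I01, g x ^ 2 ≤ (r^k)^2 := (Real.sqrt_le_left hrk.le).1 h3
  have hgi : Integrable g mu01 := Integrable.of_bound h1.aestronglyMeasurable (M^k) (Eventually.of_forall h2)
  have h5 : ∫ x, (g x ^ 2 + (r^k)^2) ∂mu01 = (∫ x, g x ^ 2 ∂mu01) + (r^k)^2 := by
    rw [integral_add (sq_int h1 h2) (integrable_const _)]; simp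
  have h6 : ∫ x, 2 * r^k * g x ∂mu01 ≤ ∫ x, (g x ^ 2 + (r^k)^2) ∂mu01 := by
    apply integral_mono (hgi.const_mul _) ((sq_int h1 h2).add (integrable_const _))
    intro x
    have := sq_nonneg (g x - r^k)
    simp only [Pi.add_apply]
    linarith
  rw [integral_const_mul, h5] at h6
  have h7 : r^k * (∫ x, g x ∂mu01) ≤ r^k * r^k := by nlinarith
  exact le_of_mul_le_mul_left h7 hrk
end Percolation
namespace Percolation
lemma dT_mono {n : ℕ} {β : Fin n → Fin n → ℝ} (h0 : ∀ i j, 0 ≤ β i j) (k : ℕ) (i : Fin n) :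
    0 ≤ (dT β)^[k] (fun _ => 1) i := by
  induction k generalizing i with
  | zero => simp
  | succ k ih =>
    rw [Function.iterate_succ_apply']
    exact Finset.sum_nonneg fun j _ => mul_nonneg (div_nonneg (h0 _ _) (Nat.cast_nonneg _)) (ih j)

lemma row_sum {n : ℕ} {β : Fin n → Fin n → ℝ} {B : ℝ} (hB0 : 0 ≤ B) (hB : ∀ i j, β i j ≤ B) (i : Fin n) :
    ∑ j, β i j / n ≤ B := by
  rw [← Finset.sum_div]
  apply div_le_of_le_mul₀ (Nat.cast_nonneg _) hB0
  refine (Finset.sum_le_sum fun j _ => hB i j).trans ?_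
  simp [mul_comm]

lemma dT_bdd {n : ℕ} {β : Fin n → Fin n → ℝ} (h0 : ∀ i j, 0 ≤ β i j) {B : ℝ} (hB0 : 0 ≤ B) (hB : ∀ i j, β i j ≤ B)
    (k : ℕ) (i : Fin n) :
    (dT β)^[k] (fun _ => 1) i ≤ B^k := by
  induction k generalizing i with
  | zero => simp
  | succ k ih =>
    rw [Function.iterate_succ_apply']
    unfold dT
    calc _ ≤ ∑ j, β i j / n * B^k := Finset.sum_le_sum fun j _ => mul_le_mul_of_nonneg_left (ih j) (div_nonneg (h0 _ _) (Nat.cast_nonneg _))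
      _ = (∑ j, β i j / n) * B^k := by rw [Finset.sum_mul]
      _ ≤ B * B^k := by gcongr; exact row_sum hB0 hB i
      _ = _ := by ring

/-- The Lyapunov function. -/
lemma exists_h {n : ℕ} {β : Fin n → Fin n → ℝ} (hs : ∀ i j, β i j = β j i) (h0 : ∀ i j, 0 ≤ β i j) {B : ℝ} (hB0 : 0 ≤ B) (hB : ∀ i j, β i j ≤ B)
    (k : ℕ) (hk : B * homDensityG β (SimpleGraph.pathGraph (k+1)) ≤ 1/2) :
    ∃ h : Fin n → ℝ, (∀ i, 0 ≤ h i) ∧ (∀ i, h i ≤ ∑ j ∈ Finset.range (k+1), B^j) ∧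
      ∀ i, ∑ j, β i j / n * h j ≤ h i - 1/2 := by
  refine ⟨fun i => ∑ j ∈ Finset.range (k+1), (dT β)^[j] (fun _ => 1) i, fun i => Finset.sum_nonneg fun j _ => dT_mono h0 j i,
    fun i => Finset.sum_le_sum fun j _ => dT_bdd h0 hB0 hB j i, fun i => ?_⟩
  have h1 : ∑ j, β i j / n * (∑ m ∈ Finset.range (k+1), (dT β)^[m] (fun _ => 1) j) =
      ∑ m ∈ Finset.range (k+1), (dT β)^[m+1] (fun _ => 1) i := by
    simp only [Function.iterate_succ_apply']
    simp only [Finset.mul_sum]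
    rw [Finset.sum_comm]
    rfl
  rw [h1]
  have h2 : (dT β)^[k+1] (fun _ => 1) i ≤ 1/2 := by
    refine le_trans ?_ hk
    rw [homDensityG_path β hs, Function.iterate_succ_apply', Finset.sum_div, Finset.mul_sum]
    refine Finset.sum_le_sum fun j _ => ?_
    rw [div_mul_eq_mul_div, mul_div_assoc]
    exact mul_le_mul_of_nonneg_right (hB i j) (div_nonneg (dT_mono h0 k j) (Nat.cast_nonneg _))
  have h3 := Finset.sum_range_succ (fun m => (dT β)^[m] (fun _ => (1:ℝ)) i) (k+1)
  have h4 := Finset.sum_range_succ' (fun m => (dT β)^[m] (fun _ => (1:ℝ)) i) (k+1)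
  simp only [Function.iterate_zero, id] at h4
  linarith

lemma tail_n {n : ℕ} {β : Fin n → Fin n → ℝ} (hs : ∀ i j, β i j = β j i) (h0 : ∀ i j, 0 ≤ β i j) {B : ℝ} (hB0 : 0 ≤ B) (hB : ∀ i j, β i j ≤ B)
    (k : ℕ) (hk : B * homDensityG β (SimpleGraph.pathGraph (k+1)) ≤ 1/2) (H θ : ℝ) (hH : H = ∑ j ∈ Finset.range (k+1), B^j)
    (hθ0 : 0 < θ) (hθ1 : θ * H ≤ 1) (hθ2 : θ * H^2 * B ≤ 1/4) (m : ℝ) (hm : 0 ≤ m) :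
    percMeasure β (1/n) {ω | m < (C1 (graphOf ω) : ℝ)} ≤ n * ENNReal.ofReal (Real.exp (1 - θ/4 * m)) := by
  obtain ⟨h, hh0, hhH, hh⟩ := exists_h hs h0 hB0 hB k hk
  rw [← hH] at hhH
  have hval : ∀ a b, sym2Val β s(a,b) = β a b := by
    intro a b
    simp only [sym2Val, Sym2.lift_mk]
    rw [hs b a]; ring
  have hq0 : ∀ e, 0 ≤ min (1/(n:ℝ) * sym2Val β e) 1 := by
    intro e
    induction e using Sym2.ind with
    | _ a b => rw [hval]; exact le_min (mul_nonneg (by positivity) (h0 _ _)) zero_le_one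
  have hx1 : ∀ i, θ * h i ≤ 1 := fun i => (mul_le_mul_of_nonneg_left (hhH i) hθ0.le).trans hθ1
  have hx0 : ∀ i, 0 ≤ θ * h i := fun i => mul_nonneg hθ0.le (hh0 i)
  have main := comp_tail (fun e => min (1/(n:ℝ) * sym2Val β e) 1) (θ/4) (fun i => θ * h i) hq0 (fun e => min_le_right _ _) (by positivity)
    hx0 ?_ m 1 hm hx1
  · simpa [percMeasure] using main
  intro a
  have e1 : ∑ u, min (1/(n:ℝ) * sym2Val β s(a,u)) 1 * (Real.exp (θ * h u) - 1) ≤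
      ∑ u, (θ * (β a u / n * h u) + β a u / n * (θ^2*H^2)) := by
    refine Finset.sum_le_sum fun u _ => ?_
    rw [hval]
    have hb : 0 ≤ β a u / n := div_nonneg (h0 _ _) (Nat.cast_nonneg _)
    have e2 : Real.exp (θ * h u) - 1 ≤ θ * h u + θ^2*H^2 := by
      have := (abs_le.1 (Real.abs_exp_sub_one_sub_id_le (x := θ * h u) (by rw [abs_of_nonneg (hx0 u)]; exact hx1 u))).2
      have e3 : (θ * h u)^2 ≤ (θ * H)^2 := pow_le_pow_left₀ (hx0 u) (mul_le_mul_of_nonneg_left (hhH u) hθ0.le) 2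
      rw [mul_pow θ H] at e3
      linarith
    have e4 : 0 ≤ Real.exp (θ * h u) - 1 := by have := Real.one_le_exp (hx0 u); linarith
    calc _ ≤ (β a u / n) * (Real.exp (θ * h u) - 1) := by
            apply mul_le_mul_of_nonneg_right _ e4
            refine (min_le_left _ _).trans (le_of_eq ?_)
            ring
      _ ≤ (β a u / n) * (θ * h u + θ^2*H^2) := mul_le_mul_of_nonneg_left e2 hb
      _ = _ := by ring
  rw [Finset.sum_add_distrib, ← Finset.mul_sum, ← Finset.sum_mul] at e1
  have e5 := mul_le_mul_of_nonneg_left (hh a) hθ0.le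
  have e6 := mul_le_mul_of_nonneg_right (row_sum hB0 hB a) (show 0 ≤ θ^2*H^2 by positivity)
  have e7 := mul_le_mul_of_nonneg_left hθ2 hθ0.le
  nlinarith

lemma perc_prob {n : ℕ} {β : Fin n → Fin n → ℝ} (h0 : ∀ i j, 0 ≤ β i j) : IsProbabilityMeasure (percMeasure β (1/n)) := by
  have hq0 : ∀ e, 0 ≤ min (1/(n:ℝ) * sym2Val β e) 1 := by
    intro e
    induction e using Sym2.ind with
    | _ a b =>
      refine le_min (mul_nonneg (by positivity) ?_) zero_le_one
      simp only [sym2Val, Sym2.lift_mk]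
      linarith [h0 a b, h0 b a]
  have : ∀ e, IsProbabilityMeasure (bern (min (1/(n:ℝ) * sym2Val β e) 1)) := fun e => bern_prob (hq0 e) (min_le_right _ _)
  unfold percMeasure
  infer_instance
end Percolation

open Percolation MeasureTheory Filter Topology in
/-- If `(G_n)` converges to a graphon `W` with `‖T_W‖ < 1`, then there
is a constant `A` such that whp the largest component of `G_n(1/n)` has at most
`A log n` vertices. -/
theorem subcritical_log_bound
    (β : ∀ n : ℕ, Fin n → Fin n → ℝ) (βmax : ℝ)
    (hsym : ∀ n i j, β n i j = β n j i)
    (hnonneg : ∀ n i j, 0 ≤ β n i j)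
    (hdiag : ∀ n i, β n i i = 0)
    (hbound : ∀ n i j, β n i j ≤ βmax)
    (W : ℝ → ℝ → ℝ) (hW : IsGraphon W) (hconv : ConvergesTo β W)
    (hsub : opNorm W < 1) :
    ∃ A : ℝ, Tendsto
      (fun n : ℕ => percMeasure (β n) (1 / n)
        {ω | (C1 (graphOf ω) : ℝ) ≤ A * Real.log n})
      atTop (nhds 1) := by
  obtain ⟨hWm, hW0, hWs, M, hWM⟩ := hW
  have hM : ∀ x y, |W x y| ≤ M := fun x y => by rw [abs_of_nonneg (hW0 x y)]; exact hWM x y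
  obtain ⟨r, hr1, hr2⟩ := exists_between hsub
  have hr0 : 0 < r := (opNorm_nonneg W).trans_lt hr1
  set B := |βmax| + 1 with hBdef
  have hB0 : 0 < B := by positivity
  have hB : ∀ n i j, β n i j ≤ B := fun n i j => (hbound n i j).trans (by
    have := le_abs_self βmax
    linarith)
  obtain ⟨k, hk⟩ := exists_pow_lt_of_lt_one (show 0 < 1/2/B by positivity) hr2
  have hd := density_bound hWm hM hWs hr1.le hr0 k
  have hev : ∀ᶠ n in atTop, B * homDensityG (β n) (SimpleGraph.pathGraph (k+1)) ≤ 1/2 := by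
    have h1 := (hconv (k+1) (SimpleGraph.pathGraph (k+1))).eventually_lt_const (hd.trans_lt hk)
    filter_upwards [h1] with n hn
    rw [lt_div_iff₀ hB0] at hn
    linarith
  set H := ∑ j ∈ Finset.range (k+1), B^j with hH
  have hHpos : 0 < H := Finset.sum_pos (fun j _ => by positivity) (by simp)
  obtain ⟨θ, hθ0, hθ1, hθ2⟩ : ∃ θ : ℝ, 0 < θ ∧ θ * H ≤ 1 ∧ θ * H^2 * B ≤ 1/4 := by
    refine ⟨min (1/H) (1/4/(H^2*B)), by positivity, ?_, ?_⟩
    · rw [← le_div_iff₀ hHpos]; exact min_le_left _ _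
    · rw [mul_assoc, ← le_div_iff₀ (by positivity)]; exact min_le_right _ _
  refine ⟨8/θ, ?_⟩
  have hbad : Tendsto (fun n : ℕ => percMeasure (β n) (1/n) {ω | 8/θ * Real.log n < (C1 (graphOf ω) : ℝ)}) atTop (nhds 0) := by
    have hlim : Tendsto (fun n : ℕ => ENNReal.ofReal (Real.exp 1 / n)) atTop (nhds 0) := by
      have := ENNReal.tendsto_ofReal (tendsto_const_div_atTop_nhds_zero_nat (Real.exp 1))
      simpa using this
    refine tendsto_of_tendsto_of_tendsto_of_le_of_le' tendsto_const_nhds hlim (Eventually.of_forall fun _ => bot_le) ?_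
    filter_upwards [hev, eventually_ge_atTop 1] with n hn hn1
    have hn0 : (0:ℝ) < n := by exact_mod_cast hn1
    have hlog : 0 ≤ Real.log n := Real.log_natCast_nonneg n
    refine (tail_n (hsym n) (hnonneg n) hB0.le (hB n) k hn H θ hH hθ0 hθ1 hθ2 _ (by positivity)).trans (le_of_eq ?_)
    rw [← ENNReal.ofReal_natCast, ← ENNReal.ofReal_mul hn0.le]
    congr 1
    have : 1 - θ/4 * (8/θ * Real.log n) = 1 - Real.log n - Real.log n := by field_simp; ring
    rw [this, Real.exp_sub, Real.exp_sub, Real.exp_log hn0]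
    field_simp
  have hcompl : ∀ n : ℕ, percMeasure (β n) (1/n) {ω | (C1 (graphOf ω) : ℝ) ≤ 8/θ * Real.log n} =
      1 - percMeasure (β n) (1/n) {ω | 8/θ * Real.log n < (C1 (graphOf ω) : ℝ)} := by
    intro n
    have := perc_prob (hnonneg n)
    rw [← prob_compl_eq_one_sub (Set.toFinite _).measurableSet]
    congr 1
    ext ω
    simp
  simp only [hcompl]
  have := ENNReal.Tendsto.sub (tendsto_const_nhds (x := (1 : ENNReal)) (f := atTop (α := ℕ))) hbad (Or.inl ENNReal.one_ne_top)
  simpa using this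
end
end

section
/- Let W be a graphon and let (G_n) be a sequence of weighted graphs with |G_n| = n, β_max = sup_{i,j,n} β_ij(n) < ∞ and G_n → W. For each fixed k ≥ 1, the number N_k(G_n(1/n)) of vertices of G_n(1/n) lying in components with exactly k vertices satisfies (1/n)·N_k(G_n(1/n)) → (1/(k−1)!)·Σ_T ∫_{[0,1]^k} ∏_{ij∈E(T)} W(x_i,x_j) · ∏_{i=1}^k e^{−λ(x_i)} dx₁⋯dx_k in probability as n → ∞, where the sum runs over all trees T with vertex set {1,…,k}, and λ(x) = ∫₀¹ W(x,y)dy. (This limit equals P(|𝔛_W| = k), the probability that the multitype Poisson branching process associated to W has total size exactly k.) -/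
open MeasureTheory Filter Topology

noncomputable section

namespace Percolation

open MeasureTheory Filter Topology

/-- The number of vertices of `G` lying in components with exactly `k` vertices. -/
def Nk {V : Type*} (G : SimpleGraph V) (k : ℕ) : ℕ := {v | compSize G v = k}.ncard

/-- `λ(x) = ∫₀¹ W(x,y) dy`, the marginal of a graphon. -/
def lambdaW (W : ℝ → ℝ → ℝ) (x : ℝ) : ℝ := ∫ y in I01, W x y

/-- The limiting density of vertices in components of size `k`:
`(1/(k-1)!) Σ_T ∫_{[0,1]^k} ∏_{ij ∈ E(T)} W(x_i, x_j) ∏_i e^{-λ(x_i)} dx`, the sum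
running over all trees `T` with vertex set `{1, …, k}`. This is `P(|𝔛_W| = k)`. -/
def treeLimit (k : ℕ) (W : ℝ → ℝ → ℝ) : ℝ := by
  classical
  exact (1 / (Nat.factorial (k - 1) : ℝ)) *
    ∑ T : SimpleGraph (Fin k), if T.IsTree then
      ∫ x : Fin k → ℝ in Set.univ.pi fun _ => I01,
        (edgeProd T fun i j => W (x i) (x j)) * ∏ i, Real.exp (-lambdaW W (x i))
    else 0

end Percolation
set_option linter.all false
namespace Percolation
open MeasureTheory Filter Topology

lemma sym2Val_mk {α : Type*} (f : α → α → ℝ) (hf : ∀ a b, f a b = f b a) (a b : α) :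
    sym2Val f s(a, b) = f a b := by
  simp only [sym2Val, Sym2.lift_mk]
  rw [hf b a]; ring

lemma sym2Val_map {α γ : Type*} (f : α → α → ℝ) (v : γ → α) (e : Sym2 γ) :
    sym2Val f (e.map v) = sym2Val (fun i j => f (v i) (v j)) e := by
  induction e with | _ a b => simp [sym2Val]

lemma sym2Val_nonneg {α : Type*} (f : α → α → ℝ) (hf : ∀ a b, 0 ≤ f a b) (e : Sym2 α) :
    0 ≤ sym2Val f e := by
  induction e with | _ a b =>
  simp only [sym2Val, Sym2.lift_mk]
  linarith [hf a b, hf b a]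

lemma sym2Val_le {α : Type*} (f : α → α → ℝ) (B : ℝ) (hf : ∀ a b, f a b ≤ B) (e : Sym2 α) :
    sym2Val f e ≤ B := by
  induction e with | _ a b =>
  simp only [sym2Val, Sym2.lift_mk]
  linarith [hf a b, hf b a]

open Classical in
lemma edgeProd_eq {k : ℕ} (F : SimpleGraph (Fin k)) (f : Fin k → Fin k → ℝ) :
    edgeProd F f = ∏ e ∈ F.edgeFinset, sym2Val f e := by
  unfold edgeProd
  congr! 

lemma edgeProd_nonneg {k : ℕ} (F : SimpleGraph (Fin k)) (f : Fin k → Fin k → ℝ)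
    (hf : ∀ a b, 0 ≤ f a b) : 0 ≤ edgeProd F f := by
  classical
  rw [edgeProd_eq]
  exact Finset.prod_nonneg fun e _ => sym2Val_nonneg f hf e

lemma edgeProd_le {k : ℕ} (F : SimpleGraph (Fin k)) (f : Fin k → Fin k → ℝ) (B : ℝ)
    (hf : ∀ a b, 0 ≤ f a b) (hB : ∀ a b, f a b ≤ B) (hB1 : 1 ≤ B) :
    edgeProd F f ≤ B ^ (k ^ 2) := by
  classical
  rw [edgeProd_eq]
  calc _ ≤ ∏ e ∈ F.edgeFinset, B := 
        Finset.prod_le_prod (fun e _ => sym2Val_nonneg f hf e) (fun e _ => sym2Val_le f B hB e)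
    _ = B ^ F.edgeFinset.card := by simp
    _ ≤ _ := by
      apply pow_le_pow_right₀ hB1
      refine F.card_edgeFinset_le_card_choose_two.trans ?_
      simp only [Fintype.card_fin]
      exact Nat.choose_le_pow k 2

/-- graph with pendant edges -/
def pend {k m : ℕ} (F : SimpleGraph (Fin k)) (f : Fin m → Fin k) : SimpleGraph (Fin (k + m)) :=
  F.map (Fin.castAddEmb m) ⊔
    SimpleGraph.fromEdgeSet (Set.range fun j => s(Fin.castAdd m (f j), Fin.natAdd k j))

lemma edgeProd_pend {k m : ℕ} (F : SimpleGraph (Fin k)) (f : Fin m → Fin k)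
    (g : Fin (k+m) → Fin (k+m) → ℝ) (hg : ∀ a b, g a b = g b a) :
    edgeProd (pend F f) g = edgeProd F (fun i j => g (Fin.castAdd m i) (Fin.castAdd m j)) *
      ∏ j, g (Fin.castAdd m (f j)) (Fin.natAdd k j) := by
  classical
  have h1 : (pend F f).edgeFinset = 
     (F.edgeFinset.map ((Fin.castAddEmb m).sym2Map)) ∪ 
      Finset.univ.image (fun j => s(Fin.castAdd m (f j), Fin.natAdd k j)) := by
    ext e
    rw [SimpleGraph.mem_edgeFinset, pend, SimpleGraph.edgeSet_sup, SimpleGraph.edgeSet_map,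
      SimpleGraph.edgeSet_fromEdgeSet]
    simp only [SimpleGraph.mem_edgeFinset, Finset.mem_union, Finset.mem_map, Finset.mem_image,
      Finset.mem_univ, true_and, Set.mem_union, Set.mem_image, Set.mem_sdiff, Set.mem_range]
    refine or_congr Iff.rfl ⟨fun h => h.1, fun h => ⟨h, ?_⟩⟩
    obtain ⟨j, rfl⟩ := h
    simp [Sym2.isDiag_iff_proj_eq, Fin.ext_iff]
    omega
  rw [edgeProd_eq, edgeProd_eq, h1, Finset.prod_union, Finset.prod_map, Finset.prod_image]
  · congr 1
    · refine Finset.prod_congr rfl fun e _ => ?_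
      exact sym2Val_map g _ e
    · refine Finset.prod_congr rfl fun j _ => ?_
      exact sym2Val_mk g hg _ _
  · intro a _ b _ h
    simp only [Sym2.eq_iff, Fin.ext_iff, Fin.val_castAdd, Fin.val_natAdd] at h
    ext
    omega
  · rw [Finset.disjoint_left]
    intro e h1 h2
    simp only [Finset.mem_map, Finset.mem_image, Finset.mem_univ, true_and] at h1 h2
    obtain ⟨e', _, rfl⟩ := h1
    obtain ⟨j, hj⟩ := h2
    induction e' with | _ a b =>
    simp only [Function.Embedding.sym2Map_apply, Sym2.map_mk, Sym2.eq_iff, Fin.ext_iff, Fin.castAddEmb_apply,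
      Fin.val_castAdd, Fin.val_natAdd] at hj
    omega

end Percolation

namespace Percolation
open MeasureTheory Filter Topology

section gen
variable {Ω : Type*} [MeasurableSpace Ω] (μ : Measure Ω) (w : Ω → Ω → ℝ)

def lam (x : Ω) : ℝ := ∫ y, w x y ∂μ

def hom {k : ℕ} (F : SimpleGraph (Fin k)) : ℝ :=
  ∫ x : Fin k → Ω, edgeProd F (fun i j => w (x i) (x j)) ∂(Measure.pi fun _ => μ)

def Jint {k : ℕ} (F : SimpleGraph (Fin k)) : ℝ :=
  ∫ x : Fin k → Ω, edgeProd F (fun i j => w (x i) (x j)) * 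
    Real.exp (-∑ i, lam μ w (x i)) ∂(Measure.pi fun _ => μ)

structure Good (B : ℝ) : Prop where
  meas : Measurable (Function.uncurry w)
  nn : ∀ x y, 0 ≤ w x y
  sym : ∀ x y, w x y = w y x
  le : ∀ x y, w x y ≤ B
  one : 1 ≤ B

variable {μ w} {B : ℝ}

lemma Good.lam_nn (h : Good w B) (x : Ω) : 0 ≤ lam μ w x := integral_nonneg fun y => h.nn x y

lemma Good.lam_le [IsProbabilityMeasure μ] (h : Good w B) (x : Ω) : lam μ w x ≤ B := by
  have : lam μ w x ≤ ∫ y, B ∂μ := by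
    refine integral_mono_of_nonneg (.of_forall fun y => h.nn x y) (integrable_const _) 
      (.of_forall fun y => h.le x y)
  simpa using this

lemma Good.lam_meas [IsProbabilityMeasure μ] (h : Good w B) : Measurable (lam μ w) :=
  (h.meas.stronglyMeasurable.integral_prod_right (ν := μ)).measurable

lemma Good.edge_meas (h : Good w B) {k : ℕ} (F : SimpleGraph (Fin k)) :
    Measurable fun x : Fin k → Ω => edgeProd F (fun i j => w (x i) (x j)) := by
  classical
  simp only [edgeProd_eq]
  refine Finset.measurable_prod _ fun e _ => ?_
  induction e with | _ a b =>
  have h1 : ∀ a b : Fin k, Measurable fun x : Fin k → Ω => w (x a) (x b) := fun a b =>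
    (h.meas.comp ((measurable_pi_apply (X := fun _ => Ω) a).prodMk (measurable_pi_apply (X := fun _ => Ω) b)) :)
  simp only [sym2Val, Sym2.lift_mk]
  exact ((h1 a b).add (h1 b a)).div_const _

lemma pend_int [IsProbabilityMeasure μ] (h : Good w B) {k m : ℕ} (F : SimpleGraph (Fin k))
    (f : Fin m → Fin k) :
    hom μ w (pend F f) = ∫ x : Fin k → Ω, edgeProd F (fun i j => w (x i) (x j)) * 
      ∏ j, lam μ w (x (f j)) ∂(Measure.pi fun _ => μ) := by
  have h1 := (measurePreserving_piCongrLeft (fun _ : Fin (k+m) => μ) finSumFinEquiv)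
  have h2 := (measurePreserving_sumPiEquivProdPi_symm (fun _ : Fin k ⊕ Fin m => μ))
  have h3 := h1.comp h2
  unfold hom
  rw [← (h2.trans h1).integral_comp']
  rw [integral_prod]
  · congr 1
    ext x
    have : ∀ y : Fin m → Ω, edgeProd (pend F f) (fun i j => 
        w (((MeasurableEquiv.sumPiEquivProdPi fun x => Ω).symm.trans
          (MeasurableEquiv.piCongrLeft (fun x => Ω) finSumFinEquiv)) (x, y) i) 
          (((MeasurableEquiv.sumPiEquivProdPi fun x => Ω).symm.trans
          (MeasurableEquiv.piCongrLeft (fun x => Ω) finSumFinEquiv)) (x, y) j)) = 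
        edgeProd F (fun i j => w (x i) (x j)) * ∏ j, w (x (f j)) (y j) := by
      intro y
      rw [edgeProd_pend _ _ _ (fun a b => h.sym _ _)]
      have e1 : ∀ i : Fin k, ((MeasurableEquiv.sumPiEquivProdPi fun x => Ω).symm.trans
          (MeasurableEquiv.piCongrLeft (fun x => Ω) finSumFinEquiv)) (x, y) (Fin.castAdd m i) = x i := by
        intro i
        have := Equiv.piCongrLeft_apply_apply (fun _ : Fin (k+m) => Ω) finSumFinEquiv
          ((MeasurableEquiv.sumPiEquivProdPi fun x : Fin k ⊕ Fin m => Ω).symm (x, y)) (Sum.inl i)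
        exact this
      have e2 : ∀ i : Fin m, ((MeasurableEquiv.sumPiEquivProdPi fun x => Ω).symm.trans
          (MeasurableEquiv.piCongrLeft (fun x => Ω) finSumFinEquiv)) (x, y) (Fin.natAdd k i) = y i := by
        intro i
        have := Equiv.piCongrLeft_apply_apply (fun _ : Fin (k+m) => Ω) finSumFinEquiv
          ((MeasurableEquiv.sumPiEquivProdPi fun x : Fin k ⊕ Fin m => Ω).symm (x, y)) (Sum.inr i)
        exact this
      simp only [e1, e2]
    simp only [this]
    rw [integral_const_mul, integral_fintype_prod_eq_prod (fun j y => w (x (f j)) y)]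
    rfl
  · refine Integrable.of_bound (C := B ^ ((k+m)^2)) ?_ (.of_forall fun x => ?_)
    · exact ((h.edge_meas (pend F f)).comp (MeasurableEquiv.measurable _)).aestronglyMeasurable
    · rw [Real.norm_of_nonneg (edgeProd_nonneg _ _ fun _ _ => h.nn _ _)]
      exact edgeProd_le _ _ _ (fun _ _ => h.nn _ _) (fun _ _ => h.le _ _) h.one

lemma hom_pend_bound [IsProbabilityMeasure μ] (h : Good w B) {k m : ℕ} (F : SimpleGraph (Fin k))
    (f : Fin m → Fin k) : |hom μ w (pend F f)| ≤ B ^ (k^2) * B ^ m := by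
  rw [pend_int h]
  have := norm_integral_le_of_norm_le_const (μ := Measure.pi fun _ : Fin k => μ)
    (f := fun x : Fin k → Ω => edgeProd F (fun i j => w (x i) (x j)) * 
      ∏ j, lam μ w (x (f j))) (C := B ^ (k^2) * B ^ m) (.of_forall fun x => ?_)
  · simpa using this
  · have h1 := edgeProd_nonneg F (fun i j => w (x i) (x j)) fun _ _ => h.nn _ _
    have h2 : 0 ≤ ∏ j, lam μ w (x (f j)) := Finset.prod_nonneg fun j _ => h.lam_nn _
    rw [Real.norm_of_nonneg (mul_nonneg h1 h2)]
    refine mul_le_mul (edgeProd_le _ _ _ (fun _ _ => h.nn _ _) (fun _ _ => h.le _ _) h.one) ?_ h2 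
      (by have := h.one; positivity)
    calc _ ≤ ∏ j : Fin m, B := Finset.prod_le_prod (fun j _ => h.lam_nn _) (fun j _ => h.lam_le _)
      _ = _ := by simp

def Jterm (μ : Measure Ω) (w : Ω → Ω → ℝ) {k : ℕ} (F : SimpleGraph (Fin k)) (m : ℕ) : ℝ :=
  (-1)^m / (m.factorial : ℝ) * ∑ f : Fin m → Fin k, hom μ w (pend F f)

lemma Jterm_bound [IsProbabilityMeasure μ] (h : Good w B) {k : ℕ} (F : SimpleGraph (Fin k)) (m : ℕ) :
    |Jterm μ w F m| ≤ B ^ (k^2) * ((k * B) ^ m / (m.factorial : ℝ)) := by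
  unfold Jterm
  rw [abs_mul, abs_div, abs_pow, abs_neg, abs_one, one_pow, Nat.abs_cast]
  calc _ ≤ 1 / (m.factorial : ℝ) * ∑ f : Fin m → Fin k, (B ^ (k^2) * B ^ m) := by
        gcongr
        exact (Finset.abs_sum_le_sum_abs _ _).trans (Finset.sum_le_sum fun f _ => hom_pend_bound h F f)
    _ = _ := by
      simp [mul_pow]; ring

lemma Jterm_eq [IsProbabilityMeasure μ] (h : Good w B) {k : ℕ} (F : SimpleGraph (Fin k)) (m : ℕ) :
    Jterm μ w F m = ∫ x : Fin k → Ω, edgeProd F (fun i j => w (x i) (x j)) * 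
      ((-∑ i, lam μ w (x i))^m / (m.factorial : ℝ)) ∂(Measure.pi fun _ => μ) := by
  unfold Jterm
  simp only [pend_int h]
  rw [← integral_finset_sum, ← integral_const_mul]
  · congr 1
    ext x
    rw [← Finset.mul_sum, neg_pow (∑ i, lam μ w (x i)), Fintype.sum_pow]
    ring
  · intro f _
    refine Integrable.of_bound (C := B ^ (k^2) * B ^ m) ?_ (.of_forall fun x => ?_)
    · refine ((h.edge_meas F).mul (Finset.measurable_prod _ fun j _ => ?_)).aestronglyMeasurable
      exact h.lam_meas.comp (measurable_pi_apply _)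
    · have h1 := edgeProd_nonneg F (fun i j => w (x i) (x j)) fun _ _ => h.nn _ _
      have h2 : 0 ≤ ∏ j, lam μ w (x (f j)) := Finset.prod_nonneg fun j _ => h.lam_nn _
      rw [Real.norm_of_nonneg (mul_nonneg h1 h2)]
      refine mul_le_mul (edgeProd_le _ _ _ (fun _ _ => h.nn _ _) (fun _ _ => h.le _ _) h.one) ?_ h2 
        (by have := h.one; positivity)
      calc _ ≤ ∏ j : Fin m, B := Finset.prod_le_prod (fun j _ => h.lam_nn _) (fun j _ => h.lam_le _)
        _ = _ := by simp

lemma Jterm_hasSum [IsProbabilityMeasure μ] (h : Good w B) {k : ℕ} (F : SimpleGraph (Fin k)) :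
    HasSum (Jterm μ w F) (Jint μ w F) := by
  have : Jterm μ w F = fun m => ∫ x : Fin k → Ω, edgeProd F (fun i j => w (x i) (x j)) * 
      ((-∑ i, lam μ w (x i))^m / (m.factorial : ℝ)) ∂(Measure.pi fun _ => μ) :=
    funext fun m => Jterm_eq h F m
  rw [this]
  have hsm : Summable fun m : ℕ => B ^ (k^2) * ((k * B) ^ m / (m.factorial : ℝ)) :=
    (Real.summable_pow_div_factorial _).mul_left _
  refine hasSum_integral_of_dominated_convergence 
    (fun m _ => B ^ (k^2) * ((k * B) ^ m / (m.factorial : ℝ))) ?_ ?_ ?_ ?_ ?_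
  · intro m
    refine ((h.edge_meas F).mul (((Finset.measurable_sum _ fun j _ => ?_).neg.pow_const m).div_const _)).aestronglyMeasurable
    exact h.lam_meas.comp (measurable_pi_apply _)
  · intro m
    refine .of_forall fun x => ?_
    have h1 := edgeProd_nonneg F (fun i j => w (x i) (x j)) fun _ _ => h.nn _ _
    have h2 : 0 ≤ ∑ i, lam μ w (x i) := Finset.sum_nonneg fun j _ => h.lam_nn _
    have h3 : ∑ i, lam μ w (x i) ≤ k * B := by
      calc _ ≤ ∑ i : Fin k, B := Finset.sum_le_sum fun j _ => h.lam_le _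
        _ = _ := by simp
    rw [norm_mul, Real.norm_of_nonneg h1, norm_div, norm_pow, norm_neg, Real.norm_of_nonneg h2,
      Real.norm_natCast]
    gcongr
    · exact pow_nonneg (zero_le_one.trans h.one) _
    · exact (edgeProd_le _ _ _ (fun _ _ => h.nn _ _) (fun _ _ => h.le _ _) h.one)
  · exact .of_forall fun x => hsm
  · exact integrable_const _
  · refine .of_forall fun x => ?_
    refine HasSum.mul_left _ ?_
    rw [Real.exp_eq_exp_ℝ]
    exact NormedSpace.expSeries_div_hasSum_exp _

end gen

lemma Jint_tendsto {Ω' : Type*} [MeasurableSpace Ω'] {Ω : ℕ → Type*} [∀ n, MeasurableSpace (Ω n)]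
    {μ' : Measure Ω'} [IsProbabilityMeasure μ'] {μ : ∀ n, Measure (Ω n)}
    (hμ : ∀ᶠ n in atTop, IsProbabilityMeasure (μ n))
    {w' : Ω' → Ω' → ℝ} {w : ∀ n, Ω n → Ω n → ℝ} {B : ℝ} (h' : Good w' B) (h : ∀ n, Good (w n) B)
    (hc : ∀ (k : ℕ) (F : SimpleGraph (Fin k)), Tendsto (fun n => hom (μ n) (w n) F) atTop (𝓝 (hom μ' w' F)))
    {k : ℕ} (F : SimpleGraph (Fin k)) :
    Tendsto (fun n => Jint (μ n) (w n) F) atTop (𝓝 (Jint μ' w' F)) := by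
  have hsm : Summable fun m : ℕ => B ^ (k^2) * ((k * B) ^ m / (m.factorial : ℝ)) :=
    (Real.summable_pow_div_factorial _).mul_left _
  have := tendsto_tsum_of_dominated_convergence (f := fun n => Jterm (μ n) (w n) F) (g := Jterm μ' w' F)
    (𝓕 := atTop) hsm ?_ ?_
  · rw [(Jterm_hasSum h' F).tsum_eq] at this
    refine this.congr' ?_
    filter_upwards [hμ] with n hn
    exact (Jterm_hasSum (h n) F).tsum_eq
  · intro m
    exact (tendsto_finset_sum _ fun f _ => hc _ _).const_mul _
  · filter_upwards [hμ] with n hn m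
    exact Jterm_bound (h n) F m

end Percolation

namespace Percolation
open MeasureTheory Filter Topology

def unif (n : ℕ) : Measure (Fin n) := (n : ENNReal)⁻¹ • Measure.count

instance (n : ℕ) : IsFiniteMeasure (unif n) := by
  constructor
  rw [unif, Measure.smul_apply, Measure.count_apply_finite _ Set.finite_univ]
  rcases Nat.eq_zero_or_pos n with rfl | hn
  · simp
  · have : ((n:ENNReal))⁻¹ ≠ ⊤ := by simp; omega
    exact ENNReal.mul_lt_top this.lt_top (by simp)

lemma unif_prob {n : ℕ} (hn : 0 < n) : IsProbabilityMeasure (unif n) := by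
  constructor
  rw [unif, Measure.smul_apply, Measure.count_apply_finite _ Set.finite_univ]
  simp
  refine ENNReal.inv_mul_cancel (by simp; omega) (by simp)

lemma unif_int {n : ℕ} (f : Fin n → ℝ) : ∫ x, f x ∂(unif n) = (∑ x, f x) / n := by
  rw [integral_fintype (Integrable.of_finite)]
  simp [unif, Measure.real, Finset.mul_sum, div_eq_inv_mul]

lemma unif_pi_int {n k : ℕ} (f : (Fin k → Fin n) → ℝ) :
    ∫ x, f x ∂(Measure.pi fun _ => unif n) = (∑ x, f x) / (n:ℝ)^k := by
  rw [integral_fintype (Integrable.of_finite)]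
  simp only [Measure.real, Measure.pi_singleton]
  simp [unif, Finset.mul_sum, div_eq_inv_mul]

lemma weighted_tendsto
    (β : ∀ n : ℕ, Fin n → Fin n → ℝ) (βmax : ℝ)
    (hsym : ∀ n i j, β n i j = β n j i)
    (hnonneg : ∀ n i j, 0 ≤ β n i j)
    (hbound : ∀ n i j, β n i j ≤ βmax)
    (W : ℝ → ℝ → ℝ) (hW : IsGraphon W) (hconv : ConvergesTo β W)
    {k : ℕ} (F : SimpleGraph (Fin k)) :
    Tendsto (fun n : ℕ => (∑ v : Fin k → Fin n, (edgeProd F fun i j => β n (v i) (v j)) *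
       Real.exp (-∑ i, (∑ u, β n (v i) u) / n)) / (n:ℝ)^k) atTop
     (𝓝 (∫ x : Fin k → ℝ in Set.univ.pi fun _ => I01,
        (edgeProd F fun i j => W (x i) (x j)) * ∏ i, Real.exp (-lambdaW W (x i)))) := by
  obtain ⟨hm, h0, hs, M, hM⟩ := hW
  have hpi : (volume : Measure (Fin k → ℝ)) = Measure.pi fun _ => volume := rfl
  haveI : IsProbabilityMeasure (volume.restrict I01) := ⟨by simp [I01]⟩
  have key := Jint_tendsto (μ' := volume.restrict I01) (μ := unif) (w' := W) (w := β)
    (B := max 1 (max βmax M)) ?_ ?_ ?_ ?_ F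
  · convert key using 2 with n
    · rw [Jint, unif_pi_int]
      simp only [lam, unif_int]
    · rw [Jint, volume_pi, Measure.restrict_pi_pi]
      congr 1
      ext x
      rw [← Real.exp_sum, Finset.sum_neg_distrib]
      rfl
  · filter_upwards [eventually_gt_atTop 0] with n hn using unif_prob hn
  · exact ⟨hm, h0, hs, fun x y => (hM x y).trans (by simp), by simp⟩
  · intro n
    exact ⟨measurable_of_finite _, hnonneg n, hsym n, fun x y => (hbound n x y).trans (by simp), by simp⟩
  · intro m G
    have := hconv m G
    convert this using 2 with n
    · rw [hom, unif_pi_int]; rfl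
    · rw [hom, homDensityW, volume_pi, Measure.restrict_pi_pi]

end Percolation

namespace Percolation
open MeasureTheory Filter Topology

section prob
variable {ι : Type*} [Fintype ι] [DecidableEq ι] (q : ι → ℝ)

def wgt (e : ι) (b : Bool) : ℝ := if b then q e else 1 - q e

def Ex (f : (ι → Bool) → ℝ) : ℝ := ∑ ω, (∏ e, wgt q e (ω e)) * f ω

lemma cyl (E : Finset ι) (a : ι → Bool) :
    Ex q (fun ω => if ∀ e ∈ E, ω e = a e then 1 else 0) = ∏ e ∈ E, wgt q e (a e) := by
  classical
  unfold Ex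
  have h1 : ∀ ω : ι → Bool, (∏ e, wgt q e (ω e)) * (if ∀ e ∈ E, ω e = a e then (1:ℝ) else 0) =
      ∏ e, (wgt q e (ω e) * if e ∈ E → ω e = a e then 1 else 0) := by
    intro ω
    rw [Finset.prod_mul_distrib, Finset.prod_ite_zero]
    simp
  simp only [h1]
  rw [← Fintype.prod_sum (f := fun e b => wgt q e b * if e ∈ E → b = a e then 1 else 0)]
  rw [← Finset.prod_subset (Finset.subset_univ E)]
  · refine Finset.prod_congr rfl fun e he => ?_
    simp only [he, forall_true_left]
    cases a e <;> simp
  · intro e _ he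
    simp [he, wgt]

lemma Ex_add (f g : (ι → Bool) → ℝ) : Ex q (fun ω => f ω + g ω) = Ex q f + Ex q g := by
  simp [Ex, mul_add, Finset.sum_add_distrib]

lemma Ex_const_mul (c : ℝ) (f : (ι → Bool) → ℝ) : Ex q (fun ω => c * f ω) = c * Ex q f := by
  simp only [Ex, Finset.mul_sum]
  exact Finset.sum_congr rfl fun _ _ => by ring

lemma Ex_sum {κ : Type*} (s : Finset κ) (f : κ → (ι → Bool) → ℝ) :
    Ex q (fun ω => ∑ i ∈ s, f i ω) = ∑ i ∈ s, Ex q (f i) := by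
  simp only [Ex, Finset.mul_sum]
  rw [Finset.sum_comm]

lemma Ex_const (c : ℝ) : Ex q (fun _ => c) = c := by
  have := cyl q ∅ (fun _ => true)
  simp at this
  have h2 := Ex_const_mul q c (fun _ => 1)
  simp only [this, mul_one] at h2
  exact h2

variable {q}
lemma wgt_nonneg (h0 : ∀ e, 0 ≤ q e) (h1 : ∀ e, q e ≤ 1) (e : ι) (b : Bool) : 0 ≤ wgt q e b := by
  unfold wgt; split_ifs <;> linarith [h0 e, h1 e]

lemma Ex_mono (h0 : ∀ e, 0 ≤ q e) (h1 : ∀ e, q e ≤ 1) {f g : (ι → Bool) → ℝ} (h : ∀ ω, f ω ≤ g ω) :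
    Ex q f ≤ Ex q g :=
  Finset.sum_le_sum fun ω _ => mul_le_mul_of_nonneg_left (h ω) 
    (Finset.prod_nonneg fun e _ => wgt_nonneg h0 h1 e _)

lemma bern_singleton (p : ℝ) (b : Bool) : 
    bern p {b} = ENNReal.ofReal (if b then p else 1 - p) := by
  cases b <;> simp [bern]

instance inst_s8 (p : ℝ) : IsFiniteMeasure (bern p) := by
  constructor
  simp [bern]

lemma meas_le (h0 : ∀ e, 0 ≤ q e) (h1 : ∀ e, q e ≤ 1) (S : Set (ι → Bool)) (f : (ι → Bool) → ℝ)
    (hf : ∀ ω, 0 ≤ f ω) (hS : ∀ ω ∈ S, 1 ≤ f ω) :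
    Measure.pi (fun e => bern (q e)) S ≤ ENNReal.ofReal (Ex q f) := by
  classical
  have : S = ((Finset.univ.filter (· ∈ S) : Finset (ι → Bool)) : Set (ι → Bool)) := by ext; simp
  rw [this, ← sum_measure_singleton, Ex, ENNReal.ofReal_sum_of_nonneg]
  · refine (Finset.sum_le_sum (g := fun ω => ENNReal.ofReal ((∏ e, wgt q e (ω e)) * f ω)) ?_).trans 
      (Finset.sum_le_sum_of_subset (Finset.subset_univ _))
    intro ω hω
    simp only [Finset.mem_filter, Finset.mem_univ, true_and] at hω
    rw [Measure.pi_singleton]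
    simp only [bern_singleton]
    change ∏ x, ENNReal.ofReal (wgt q x (ω x)) ≤ _
    rw [← ENNReal.ofReal_prod_of_nonneg (fun e _ => wgt_nonneg h0 h1 e (ω e))]
    apply ENNReal.ofReal_le_ofReal
    exact le_mul_of_one_le_right (Finset.prod_nonneg fun e _ => wgt_nonneg h0 h1 e _) (hS ω hω)
  · exact fun ω _ => mul_nonneg (Finset.prod_nonneg fun e _ => wgt_nonneg h0 h1 e _) (hf ω)

end prob
end Percolation

namespace Percolation
open MeasureTheory Filter Topology

section comb
open Classical
variable {V : Type*} [Fintype V] {k : ℕ}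

def nd (k : ℕ) : Finset (Sym2 (Fin k)) := Finset.univ.filter fun e => ¬ e.IsDiag

def inE (v : Fin k ↪ V) : Finset (Sym2 V) := (nd k).image (Sym2.map v)

def outP (v : Fin k ↪ V) : Finset (Fin k × V) :=
  Finset.univ ×ˢ Finset.univ.filter fun u => u ∉ Set.range v

def outE (v : Fin k ↪ V) : Finset (Sym2 V) := (outP v).image fun p => s(v p.1, p.2)

def allE (v : Fin k ↪ V) : Finset (Sym2 V) := inE v ∪ outE v

def val (v : Fin k ↪ V) (H : SimpleGraph (Fin k)) (e : Sym2 V) : Bool :=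
  decide (e ∈ Sym2.map v '' H.edgeSet)

def Bev (v : Fin k ↪ V) (H : SimpleGraph (Fin k)) (ω : Sym2 V → Bool) : Prop :=
  ∀ e ∈ allE v, ω e = val v H e

def IsComp (G : SimpleGraph V) (v : Fin k ↪ V) : Prop :=
  (G.comap v).Connected ∧ ∀ i, ∀ u ∉ Set.range v, ¬ G.Adj (v i) u

lemma graphOf_adj (ω : Sym2 V → Bool) (a b : V) :
    (graphOf ω).Adj a b ↔ a ≠ b ∧ ω s(a,b) = true := by
  simp [graphOf, SimpleGraph.fromRel_adj, Sym2.eq_swap (a := b) (b := a)]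

lemma val_in (v : Fin k ↪ V) (H : SimpleGraph (Fin k)) (e : Sym2 (Fin k)) :
    val v H (e.map v) = true ↔ e ∈ H.edgeSet := by
  simp only [val, decide_eq_true_eq]
  exact (Sym2.map.injective v.injective).mem_set_image

lemma val_out (v : Fin k ↪ V) (H : SimpleGraph (Fin k)) (e : Sym2 V) (u : V) (hu : u ∈ e)
    (h : u ∉ Set.range v) : val v H e = false := by
  simp only [val, decide_eq_false_iff_not]
  rintro ⟨e', -, rfl⟩
  rw [Sym2.mem_map] at hu
  obtain ⟨a, -, rfl⟩ := hu
  exact h ⟨a, rfl⟩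

lemma Bev_iff (v : Fin k ↪ V) (H : SimpleGraph (Fin k)) (ω : Sym2 V → Bool) :
    Bev v H ω ↔ (graphOf ω).comap v = H ∧ ∀ i, ∀ u ∉ Set.range v, ¬ (graphOf ω).Adj (v i) u := by
  constructor
  · intro h
    constructor
    · ext i j
      rw [SimpleGraph.comap_adj, graphOf_adj]
      by_cases hij : i = j
      · subst hij; simp
      · have := h s(v i, v j) (by
          refine Finset.mem_union_left _ (Finset.mem_image.2 ⟨s(i,j), ?_, rfl⟩)
          simp [nd, hij])
        rw [this, ← Sym2.map_mk, val_in, SimpleGraph.mem_edgeSet]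
        simp [hij]
    · intro i u hu
      have := h s(v i, u) (by
        refine Finset.mem_union_right _ (Finset.mem_image.2 ⟨(i,u), ?_, rfl⟩)
        simpa [outP] using hu)
      rw [graphOf_adj, this, val_out v H _ u (by simp) hu]
      simp
  · rintro ⟨h1, h2⟩ e he
    rcases Finset.mem_union.1 he with he | he
    · obtain ⟨e, he', rfl⟩ := Finset.mem_image.1 he
      rw [Bool.eq_iff_iff, val_in, ← h1]
      induction e with | _ a b =>
      have hab : a ≠ b := by simpa [nd] using he'
      rw [SimpleGraph.mem_edgeSet, SimpleGraph.comap_adj, graphOf_adj]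
      simp [hab]
    · obtain ⟨⟨i, u⟩, hp, rfl⟩ := Finset.mem_image.1 he
      have hu : u ∉ Set.range v := by simpa [outP] using hp
      rw [val_out v H _ u (by simp) hu]
      have := h2 i u hu
      rw [graphOf_adj] at this
      have hne : v i ≠ u := fun h => hu ⟨i, h⟩
      simpa [hne] using this

lemma sum_Bev (v : Fin k ↪ V) (ω : Sym2 V → Bool) :
    (if IsComp (graphOf ω) v then (1:ℝ) else 0) = 
      ∑ H ∈ Finset.univ.filter (fun H : SimpleGraph (Fin k) => H.Connected), if Bev v H ω then 1 else 0 := by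
  rw [← Finset.sum_filter, Finset.filter_filter]
  simp only [Finset.sum_const, nsmul_eq_mul, mul_one, Bev_iff]
  split_ifs with h
  · have : (Finset.univ.filter fun H : SimpleGraph (Fin k) => H.Connected ∧ (graphOf ω).comap v = H ∧ ∀ i, ∀ u ∉ Set.range v, ¬ (graphOf ω).Adj (v i) u) = {(graphOf ω).comap v} := by
      ext H
      simp only [Finset.mem_filter, Finset.mem_univ, true_and, Finset.mem_singleton]
      constructor
      · rintro ⟨_, h, _⟩; exact h.symm
      · rintro rfl; exact ⟨h.1, rfl, h.2⟩
    rw [this]; simp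
  · rw [Finset.filter_eq_empty_iff.2]
    · simp
    · rintro H - ⟨h1, rfl, h2⟩
      exact h ⟨h1, h2⟩

lemma reach_aux (G : SimpleGraph V) (v : Fin k ↪ V)
    {x w : V} (hr : G.Reachable x w)
    (h : ∀ y, G.Reachable x y → ∀ z, G.Adj y z → y ∈ Set.range v → z ∈ Set.range v) :
    ∀ i, v i = x → ∃ j, v j = w ∧ (G.comap v).Reachable i j := by
  obtain ⟨p⟩ := hr
  induction p with
  | nil => exact fun i hi => ⟨i, hi, SimpleGraph.Reachable.refl _⟩
  | cons hadj p ih =>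
    intro i hi
    obtain ⟨i', hi'⟩ := h _ (SimpleGraph.Reachable.refl _) _ hadj ⟨i, hi⟩
    obtain ⟨j, hj, hr⟩ := ih (fun y hy z hz hm => h y (hadj.reachable.trans hy) z hz hm) i' hi'
    refine ⟨j, hj, SimpleGraph.Reachable.trans ?_ hr⟩
    refine SimpleGraph.Adj.reachable ?_
    rw [SimpleGraph.comap_adj, hi, hi']
    exact hadj

lemma IsComp.eq {G : SimpleGraph V} {v : Fin k ↪ V} (h : IsComp G v) {x : V} (hx : x ∈ Set.range v) :
    {w | G.Reachable x w} = Set.range v := by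
  obtain ⟨i, rfl⟩ := hx
  ext w
  constructor
  · intro hr
    obtain ⟨j, hj, -⟩ := reach_aux G v hr (fun y _ z hz hm => by
      obtain ⟨j, rfl⟩ := hm
      by_contra hc
      exact h.2 j z hc hz) i rfl
    exact ⟨j, hj⟩
  · rintro ⟨j, rfl⟩
    have := h.1.preconnected i j
    exact this.map (SimpleGraph.Hom.comap v G)

lemma isComp_of_eq {G : SimpleGraph V} {v : Fin k ↪ V} {x : V} 
    (h : {w | G.Reachable x w} = Set.range v) : IsComp G v := by
  have hx : x ∈ Set.range v := by rw [← h]; exact SimpleGraph.Reachable.refl x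
  obtain ⟨i0, hi0⟩ := hx
  have hcl : ∀ y z, G.Adj y z → y ∈ Set.range v → z ∈ Set.range v := by
    intro y z hz hy
    rw [← h] at hy ⊢
    exact SimpleGraph.Reachable.trans hy hz.reachable
  have hre : ∀ j, (G.comap v).Reachable i0 j := by
    intro j
    have hj : G.Reachable x (v j) := by
      have : v j ∈ {w | G.Reachable x w} := by rw [h]; exact ⟨j, rfl⟩
      exact this
    obtain ⟨j', hj', hr⟩ := reach_aux G v hj (fun y _ z hz hm => hcl y z hz hm) i0 hi0
    rwa [v.injective hj'] at hr
  refine ⟨?_, ?_⟩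
  · haveI : Nonempty (Fin k) := ⟨i0⟩
    exact SimpleGraph.Connected.mk fun a b => (hre a).symm.trans (hre b)
  · intro i u hu hadj
    exact hu (hcl _ _ hadj ⟨i, rfl⟩)

lemma card_range_eq (S : Set V) (hS : S.ncard = k) :
    (Finset.univ.filter fun v : Fin k ↪ V => Set.range v = S).card = k.factorial := by
  have e0 : Fin k ≃ S := by
    refine Fintype.equivOfCardEq ?_
    rw [Fintype.card_fin, ← hS, ← Nat.card_coe_set_eq, Nat.card_eq_fintype_card]
  have e : {v : Fin k ↪ V // Set.range v = S} ≃ (Fin k ≃ S) :=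
    { toFun := fun v => (Equiv.ofInjective v.1 v.1.injective).trans (Equiv.setCongr v.2)
      invFun := fun e => ⟨e.toEmbedding.trans (Function.Embedding.subtype _), by
        ext x
        simp
        exact ⟨by rintro ⟨y, rfl⟩; exact (e y).2, fun h => ⟨e.symm ⟨x, h⟩, by simp⟩⟩⟩
      left_inv := fun v => by ext; simp
      right_inv := fun e => by ext; simp }
  rw [← Fintype.card_subtype, Fintype.card_congr e, Fintype.card_equiv e0, Fintype.card_fin]

def Xc (k : ℕ) (G : SimpleGraph V) : ℝ := ∑ v : Fin k ↪ V, if IsComp G v then (1:ℝ) else 0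

lemma ncard_range_emb (v : Fin k ↪ V) : (Set.range v).ncard = k := by
  rw [← Set.image_univ, Set.ncard_image_of_injective _ v.injective, Set.ncard_univ]
  simp

lemma count (hk : 1 ≤ k) (G : SimpleGraph V) : Xc k G = ((k-1).factorial : ℝ) * Nk G k := by
  have h1 : (k:ℝ) * Xc k G = ∑ v : Fin k ↪ V, ∑ x : V, if IsComp G v ∧ x ∈ Set.range v then (1:ℝ) else 0 := by
    rw [Xc, Finset.mul_sum]
    refine Finset.sum_congr rfl fun v _ => ?_
    by_cases h : IsComp G v
    · simp only [h, true_and, if_true, mul_one]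
      rw [← Finset.sum_filter, Finset.sum_const, nsmul_eq_mul, mul_one]
      congr 1
      have := ncard_range_emb v
      rw [Set.ncard_eq_toFinset_card'] at this
      refine this.symm.trans ?_
      congr 1
      ext x; simp
    · simp [h]
  have h2 : ∀ x : V, ∑ v : Fin k ↪ V, (if IsComp G v ∧ x ∈ Set.range v then (1:ℝ) else 0) = 
      if compSize G x = k then (k.factorial : ℝ) else 0 := by
    intro x
    rw [← Finset.sum_filter, Finset.sum_const, nsmul_eq_mul, mul_one]
    have : (Finset.univ.filter fun v : Fin k ↪ V => IsComp G v ∧ x ∈ Set.range v) =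
        Finset.univ.filter fun v : Fin k ↪ V => Set.range v = {w | G.Reachable x w} := by
      ext v
      simp only [Finset.mem_filter, Finset.mem_univ, true_and]
      constructor
      · rintro ⟨h, hx⟩; exact (h.eq hx).symm
      · intro h
        refine ⟨isComp_of_eq h.symm, ?_⟩
        rw [h]; exact SimpleGraph.Reachable.refl x
    rw [this]
    split_ifs with hc
    · rw [card_range_eq _ hc]
    · rw [Finset.filter_eq_empty_iff.2]
      · simp
      · intro v _ hv
        apply hc
        rw [compSize, ← hv, ncard_range_emb]
  rw [Finset.sum_comm] at h1
  simp only [h2] at h1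
  rw [← Finset.sum_filter, Finset.sum_const, nsmul_eq_mul] at h1
  have h3 : (Finset.univ.filter fun x => compSize G x = k).card = Nk G k := by
    rw [Nk, Set.ncard_eq_toFinset_card']
    congr 1
    ext x; simp
  rw [h3] at h1
  obtain ⟨m, rfl⟩ : ∃ m, k = m + 1 := ⟨k-1, by omega⟩
  rw [Nat.factorial_succ] at h1
  have : ((m+1 : ℕ) : ℝ) ≠ 0 := by positivity
  apply mul_left_cancel₀ this
  rw [h1, Nat.add_sub_cancel]
  push_cast
  ring

end comb
end Percolation

namespace Percolation
open MeasureTheory Filter Topology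

section sec
open Classical
variable {V : Type*} [Fintype V] {k : ℕ} {q : Sym2 V → ℝ}

def PB (q : Sym2 V → ℝ) (v : Fin k ↪ V) (H : SimpleGraph (Fin k)) : ℝ := 
  ∏ e ∈ allE v, wgt q e (val v H e)

lemma Ex_Bev (v : Fin k ↪ V) (H : SimpleGraph (Fin k)) :
    Ex q (fun ω => if Bev v H ω then 1 else 0) = PB q v H := by
  rw [PB, ← cyl q (allE v) (val v H)]
  congr! 

lemma PB_nonneg (h0 : ∀ e, 0 ≤ q e) (h1 : ∀ e, q e ≤ 1) (v : Fin k ↪ V) (H : SimpleGraph (Fin k)) :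
    0 ≤ PB q v H := Finset.prod_nonneg fun e _ => wgt_nonneg h0 h1 e _

def conn (k : ℕ) : Finset (SimpleGraph (Fin k)) := Finset.univ.filter fun H => H.Connected

lemma Ex_comp (v : Fin k ↪ V) : 
    Ex q (fun ω => if IsComp (graphOf ω) v then 1 else 0) = ∑ H ∈ conn k, PB q v H := by
  simp only [sum_Bev]
  rw [Ex_sum]
  exact Finset.sum_congr rfl fun H _ => Ex_Bev v H

lemma Ex_Xc : Ex q (fun ω => Xc k (graphOf ω)) = ∑ v : Fin k ↪ V, ∑ H ∈ conn k, PB q v H := by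
  simp only [Xc]
  rw [Ex_sum]
  exact Finset.sum_congr rfl fun H _ => Ex_comp H

lemma allE_mem (v : Fin k ↪ V) (e : Sym2 V) (he : e ∈ allE v) : ∃ i, v i ∈ e := by
  rcases Finset.mem_union.1 he with he | he
  · obtain ⟨e, he', rfl⟩ := Finset.mem_image.1 he
    induction e with | _ a b => exact ⟨a, by simp⟩
  · obtain ⟨⟨i, u⟩, hp, rfl⟩ := Finset.mem_image.1 he
    exact ⟨i, by simp⟩

lemma joint (h0 : ∀ e, 0 ≤ q e) (h1 : ∀ e, q e ≤ 1) {δ : ℝ} (hδ : ∀ e, q e ≤ δ) (hδ1 : δ ≤ 1) (hδ0 : 0 ≤ δ)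
    (v v' : Fin k ↪ V) (H H' : SimpleGraph (Fin k)) (hd : Disjoint (Set.range v) (Set.range v')) :
    (1 - δ) ^ (k^2) * Ex q (fun ω => (if Bev v H ω then 1 else 0) * (if Bev v' H' ω then 1 else 0)) ≤ 
      PB q v H * PB q v' H' := by
  set a : Sym2 V → Bool := fun e => if e ∈ allE v then val v H e else val v' H' e with ha
  have hE : Ex q (fun ω => (if Bev v H ω then 1 else 0) * (if Bev v' H' ω then 1 else 0)) ≤ 
      ∏ e ∈ allE v ∪ allE v', wgt q e (a e) := by
    rw [← cyl]
    refine Ex_mono h0 h1 fun ω => ?_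
    by_cases hb : Bev v H ω
    · by_cases hb' : Bev v' H' ω
      · rw [if_pos hb, if_pos hb', if_pos]
        · simp
        · intro e he
          simp only [ha]
          split_ifs with h
          · exact hb e h
          · exact hb' e ((Finset.mem_union.1 he).resolve_left h)
      · rw [if_neg hb', mul_zero]
        split_ifs <;> norm_num
    · rw [if_neg hb, zero_mul]
      split_ifs <;> norm_num
  have hP : PB q v H * PB q v' H' = (∏ e ∈ allE v ∪ allE v', wgt q e (a e)) * 
      ∏ e ∈ allE v' ∩ allE v, wgt q e (val v' H' e) := by
    have e1 : PB q v H = ∏ e ∈ allE v, wgt q e (a e) :=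
      Finset.prod_congr rfl fun e he => by simp [ha, he]
    have e2 : PB q v' H' = (∏ e ∈ allE v' ∩ allE v, wgt q e (val v' H' e)) * 
        ∏ e ∈ allE v' \ allE v, wgt q e (a e) := by
      rw [PB, ← Finset.prod_inter_mul_prod_sdiff (allE v') (allE v)]
      congr 1
      refine Finset.prod_congr rfl fun e he => ?_
      rw [Finset.mem_sdiff] at he
      simp [ha, he.2]
    rw [← Finset.union_sdiff_self_eq_union, Finset.prod_union Finset.disjoint_sdiff, e1, e2]
    ring
  have hint : allE v' ∩ allE v ⊆ (Finset.univ : Finset (Fin k × Fin k)).image fun p => s(v p.1, v' p.2) := by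
    intro e he
    rw [Finset.mem_inter] at he
    obtain ⟨j, hj⟩ := allE_mem _ _ he.1
    obtain ⟨i, hi⟩ := allE_mem _ _ he.2
    refine Finset.mem_image.2 ⟨(i,j), Finset.mem_univ _, ?_⟩
    have hne : v i ≠ v' j := fun h => Set.disjoint_left.1 hd ⟨i, rfl⟩ ⟨j, h.symm⟩
    exact ((Sym2.mem_and_mem_iff hne).1 ⟨hi, hj⟩).symm
  have hcard : (allE v' ∩ allE v).card ≤ k^2 := by
    refine (Finset.card_le_card hint).trans (Finset.card_image_le.trans ?_)
    simp [pow_two]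
  have hprod : (1-δ)^(k^2) ≤ ∏ e ∈ allE v' ∩ allE v, wgt q e (val v' H' e) := by
    calc (1-δ)^(k^2) ≤ (1-δ)^(allE v' ∩ allE v).card :=
          pow_le_pow_of_le_one (by linarith) (by linarith) hcard
      _ = ∏ e ∈ allE v' ∩ allE v, (1-δ) := by simp
      _ ≤ _ := by
        refine Finset.prod_le_prod (fun _ _ => by linarith) fun e he => ?_
        rw [Finset.mem_inter] at he
        obtain ⟨i, hi⟩ := allE_mem _ _ he.2
        rw [val_out v' H' e (v i) hi (Set.disjoint_left.1 hd ⟨i, rfl⟩)]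
        have := hδ e
        simp only [wgt, Bool.false_eq_true, if_false]
        linarith
  rw [hP, mul_comm]
  exact mul_le_mul hE hprod (pow_nonneg (by linarith) _) 
    (Finset.prod_nonneg fun e _ => wgt_nonneg h0 h1 e _)

lemma second (h0 : ∀ e, 0 ≤ q e) (h1 : ∀ e, q e ≤ 1) {δ : ℝ} (hδ : ∀ e, q e ≤ δ) (hδ1 : δ ≤ 1) (hδ0 : 0 ≤ δ) :
    (1 - δ) ^ (k^2) * Ex q (fun ω => Xc k (graphOf ω) ^ 2) ≤ 
      k.factorial * Ex q (fun ω => Xc k (graphOf ω)) + Ex q (fun ω => Xc k (graphOf ω)) ^ 2 := by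
  set D : Finset ((Fin k ↪ V) × (Fin k ↪ V)) := 
    Finset.univ.filter fun p => Disjoint (Set.range p.1) (Set.range p.2) with hD
  set I : (Fin k ↪ V) → (Sym2 V → Bool) → ℝ := fun v ω => if IsComp (graphOf ω) v then 1 else 0 with hI
  have hI0 : ∀ v ω, 0 ≤ I v ω := fun v ω => by simp only [hI]; split_ifs <;> norm_num
  have hpt : ∀ ω : Sym2 V → Bool, Xc k (graphOf ω) ^ 2 ≤ 
      k.factorial * Xc k (graphOf ω) + ∑ p ∈ D, I p.1 ω * I p.2 ω := by
    intro ω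
    have hsq : Xc k (graphOf ω) ^ 2 = ∑ p : (Fin k ↪ V) × (Fin k ↪ V), I p.1 ω * I p.2 ω := by
      rw [pow_two, Xc, Finset.sum_mul_sum, ← Finset.univ_product_univ, Finset.sum_product]
    rw [hsq, ← Finset.sum_filter_add_sum_filter_not Finset.univ 
      (fun p : (Fin k ↪ V) × (Fin k ↪ V) => Disjoint (Set.range p.1) (Set.range p.2)), add_comm]
    gcongr
    rw [Finset.sum_filter, ← Finset.univ_product_univ, Finset.sum_product, Xc, Finset.mul_sum]
    refine Finset.sum_le_sum fun v _ => ?_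
    by_cases hv : IsComp (graphOf ω) v
    · rw [if_pos hv, mul_one, ← card_range_eq (Set.range v) (ncard_range_emb v)]
      rw [← Finset.sum_filter]
      calc _ ≤ ∑ v' ∈ Finset.univ.filter (fun v' : Fin k ↪ V => ¬ Disjoint (Set.range v) (Set.range v')), 
            if Set.range v' = Set.range v then (1:ℝ) else 0 := by
            refine Finset.sum_le_sum fun v' hv' => ?_
            simp only [Finset.mem_filter, Finset.mem_univ, true_and, Set.not_disjoint_iff] at hv'
            obtain ⟨x, hx, hx'⟩ := hv'
            simp only [hI, if_pos hv, one_mul]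
            by_cases hc : IsComp (graphOf ω) v'
            · rw [if_pos hc, if_pos (by rw [← hc.eq hx', hv.eq hx])]
            · rw [if_neg hc]; split_ifs <;> norm_num
        _ ≤ ∑ v' : Fin k ↪ V, if Set.range v' = Set.range v then (1:ℝ) else 0 := 
            Finset.sum_le_sum_of_subset_of_nonneg (Finset.subset_univ _) 
              (fun _ _ _ => by split_ifs <;> norm_num)
        _ = _ := by rw [← Finset.sum_filter]; simp
    · simp [hI, hv]
  have hpow : 0 ≤ (1-δ)^(k^2) := pow_nonneg (by linarith) _
  have hpow1 : (1-δ)^(k^2) ≤ 1 := pow_le_one₀ (by linarith) (by linarith)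
  have hEX : 0 ≤ Ex q (fun ω => Xc k (graphOf ω)) := by
    rw [Ex_Xc]
    exact Finset.sum_nonneg fun v _ => Finset.sum_nonneg fun H _ => PB_nonneg h0 h1 v H
  calc _ ≤ (1 - δ) ^ (k^2) * Ex q (fun ω => k.factorial * Xc k (graphOf ω) + ∑ p ∈ D, I p.1 ω * I p.2 ω) :=
        mul_le_mul_of_nonneg_left (Ex_mono h0 h1 hpt) hpow
    _ = (1 - δ) ^ (k^2) * (k.factorial * Ex q (fun ω => Xc k (graphOf ω))) + 
        ∑ p ∈ D, (1 - δ) ^ (k^2) * Ex q (fun ω => I p.1 ω * I p.2 ω) := by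
        rw [Ex_add, Ex_const_mul, Ex_sum, mul_add, Finset.mul_sum]
    _ ≤ k.factorial * Ex q (fun ω => Xc k (graphOf ω)) + 
        ∑ p ∈ D, (∑ H ∈ conn k, PB q p.1 H) * (∑ H ∈ conn k, PB q p.2 H) := by
        refine add_le_add (mul_le_of_le_one_left (by positivity) hpow1) (Finset.sum_le_sum fun p hp => ?_)
        have hd : Disjoint (Set.range p.1) (Set.range p.2) := (Finset.mem_filter.1 hp).2
        simp only [hI, sum_Bev, Finset.sum_mul_sum]
        rw [Ex_sum, Finset.mul_sum]
        refine Finset.sum_le_sum fun H _ => ?_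
        rw [Ex_sum, Finset.mul_sum]
        exact Finset.sum_le_sum fun H' _ => joint h0 h1 hδ hδ1 hδ0 _ _ _ _ hd
    _ ≤ k.factorial * Ex q (fun ω => Xc k (graphOf ω)) + 
        ∑ p : (Fin k ↪ V) × (Fin k ↪ V), (∑ H ∈ conn k, PB q p.1 H) * (∑ H ∈ conn k, PB q p.2 H) := by
        gcongr
        · intro p _ _
          exact mul_nonneg (Finset.sum_nonneg fun H _ => PB_nonneg h0 h1 _ H) 
            (Finset.sum_nonneg fun H _ => PB_nonneg h0 h1 _ H)
        · exact Finset.subset_univ _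
    _ = _ := by
        rw [Ex_Xc, pow_two, Finset.sum_mul_sum, ← Finset.univ_product_univ, Finset.sum_product]

end sec
end Percolation

namespace Percolation
open MeasureTheory Filter Topology

lemma abs_prod_sub_le {ι : Type*} (s : Finset ι) (a b : ι → ℝ) (ha0 : ∀ i ∈ s, 0 ≤ a i) (ha1 : ∀ i ∈ s, a i ≤ 1)
    (hb0 : ∀ i ∈ s, 0 ≤ b i) (hb1 : ∀ i ∈ s, b i ≤ 1) :
    |∏ i ∈ s, a i - ∏ i ∈ s, b i| ≤ ∑ i ∈ s, |a i - b i| := by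
  classical
  induction s using Finset.induction_on with
  | empty => simp
  | insert x s hx ih =>
    simp only [Finset.mem_insert, forall_eq_or_imp] at ha0 ha1 hb0 hb1
    rw [Finset.prod_insert hx, Finset.prod_insert hx, Finset.sum_insert hx]
    have ih' := ih ha0.2 ha1.2 hb0.2 hb1.2
    have e : a x * ∏ i ∈ s, a i - b x * ∏ i ∈ s, b i = 
      (a x - b x) * (∏ i ∈ s, a i) + b x * (∏ i ∈ s, a i - ∏ i ∈ s, b i) := by ring
    rw [e]
    refine (abs_add_le _ _).trans (add_le_add ?_ ?_)
    · rw [abs_mul, abs_of_nonneg (Finset.prod_nonneg ha0.2)]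
      exact mul_le_of_le_one_right (abs_nonneg _) (Finset.prod_le_one ha0.2 ha1.2)
    · rw [abs_mul, abs_of_nonneg hb0.1]
      exact (mul_le_of_le_one_left (abs_nonneg _) hb1.1).trans ih'

section G
open Classical
variable {V : Type*} [Fintype V] {k : ℕ} {q : Sym2 V → ℝ}

def RB (q : Sym2 V → ℝ) (v : Fin k ↪ V) (H : SimpleGraph (Fin k)) : ℝ := 
  (∏ e ∈ nd k \ H.edgeFinset, (1 - q (e.map v))) * ∏ p ∈ outP v, (1 - q s(v p.1, p.2))

lemma PB_eq (v : Fin k ↪ V) (H : SimpleGraph (Fin k)) : 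
    PB q v H = (∏ e ∈ H.edgeFinset, q (e.map v)) * RB q v H := by
  unfold PB allE
  rw [Finset.prod_union]
  · unfold inE outE RB
    rw [Finset.prod_image (Set.injOn_of_injective (Sym2.map.injective v.injective)), Finset.prod_image]
    · rw [← mul_assoc]
      congr 1
      · have hs : H.edgeFinset ⊆ nd k := by
          intro e he
          simp only [nd, Finset.mem_filter, Finset.mem_univ, true_and]
          exact H.not_isDiag_of_mem_edgeFinset he
        rw [← Finset.prod_sdiff hs, mul_comm]
        congr 1
        · refine Finset.prod_congr rfl fun e he => ?_
          rw [(val_in v H e).2 (SimpleGraph.mem_edgeFinset.1 he)]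
          simp [wgt]
        · refine Finset.prod_congr rfl fun e he => ?_
          have : ¬ val v H (e.map v) = true := by
            rw [val_in]
            rw [Finset.mem_sdiff, SimpleGraph.mem_edgeFinset] at he
            exact he.2
          simp [wgt, this]
      · refine Finset.prod_congr rfl fun p hp => ?_
        have hu : p.2 ∉ Set.range v := by simpa [outP] using hp
        rw [val_out v H _ p.2 (by simp) hu]
        simp [wgt]
    · rintro ⟨i, u⟩ hp ⟨i', u'⟩ hp' h
      have hu : u ∉ Set.range v := by simpa [outP] using hp
      have hu' : u' ∉ Set.range v := by simpa [outP] using hp'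
      simp only [Sym2.eq_iff] at h
      rcases h with ⟨h1, h2⟩ | ⟨h1, h2⟩
      · rw [v.injective h1, h2]
      · exact (hu ⟨i', h2.symm⟩).elim
  · rw [Finset.disjoint_left]
    intro e he he'
    obtain ⟨⟨i, u⟩, hp, rfl⟩ := Finset.mem_image.1 he'
    obtain ⟨e, -, h⟩ := Finset.mem_image.1 he
    have hu : u ∉ Set.range v := by simpa [outP] using hp
    have : u ∈ e.map v := by rw [h]; simp
    rw [Sym2.mem_map] at this
    obtain ⟨a, -, rfl⟩ := this
    exact hu ⟨a, rfl⟩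

lemma RB_bounds (h0 : ∀ e, 0 ≤ q e) (h1 : ∀ e, q e ≤ 1) (v : Fin k ↪ V) (H : SimpleGraph (Fin k)) :
    0 ≤ RB q v H ∧ RB q v H ≤ 1 := by
  have a : ∀ e, 0 ≤ 1 - q e := fun e => by linarith [h1 e]
  have b : ∀ e, 1 - q e ≤ 1 := fun e => by linarith [h0 e]
  refine ⟨mul_nonneg (Finset.prod_nonneg fun _ _ => a _) (Finset.prod_nonneg fun _ _ => a _), ?_⟩
  exact mul_le_one₀ (Finset.prod_le_one (fun _ _ => a _) (fun _ _ => b _)) 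
    (Finset.prod_nonneg fun _ _ => a _) (Finset.prod_le_one (fun _ _ => a _) (fun _ _ => b _))

lemma RB_est (h0 : ∀ e, 0 ≤ q e) (h1 : ∀ e, q e ≤ 1) {δ : ℝ} (hδ : ∀ e, q e ≤ δ)
    (v : Fin k ↪ V) (H : SimpleGraph (Fin k)) :
    |RB q v H - Real.exp (-∑ i, ∑ u, q s(v i, u))| ≤ 
      Fintype.card (Sym2 (Fin k)) * δ + k * k * δ + k * Fintype.card V * δ^2 := by
  have a : ∀ e, 0 ≤ 1 - q e := fun e => by linarith [h1 e]
  have b : ∀ e, 1 - q e ≤ 1 := fun e => by linarith [h0 e]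
  have hc0 : ∀ e, 0 ≤ Real.exp (-q e) := fun e => (Real.exp_pos _).le
  have hc1 : ∀ e, Real.exp (-q e) ≤ 1 := fun e => Real.exp_le_one_iff.2 (by linarith [h0 e])
  set S : Finset (Fin k × V) := Finset.univ ×ˢ Finset.univ.map v with hS
  have hexp : Real.exp (-∑ i, ∑ u, q s(v i, u)) = 
      (∏ p ∈ S, Real.exp (-q s(v p.1, p.2))) * ∏ p ∈ outP v, Real.exp (-q s(v p.1, p.2)) := by
    rw [← Finset.prod_union]
    · have : S ∪ outP v = Finset.univ := by
        ext ⟨i, u⟩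
        simp only [hS, outP, Finset.mem_union, Finset.mem_product, Finset.mem_map, Finset.mem_filter, 
          Finset.mem_univ, true_and, Set.mem_range, iff_true]
        exact Classical.em _
      rw [this, ← Real.exp_sum, Finset.sum_neg_distrib, ← Finset.univ_product_univ, Finset.sum_product]
    · rw [Finset.disjoint_left]
      rintro ⟨i, u⟩ h1 h2
      simp only [hS, outP, Finset.mem_product, Finset.mem_map, Finset.mem_filter, 
          Finset.mem_univ, true_and, Set.mem_range] at h1 h2
      exact h2 h1
  set A := ∏ e ∈ nd k \ H.edgeFinset, (1 - q (e.map v))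
  set D := ∏ p ∈ S, Real.exp (-q s(v p.1, p.2))
  set P := ∏ p ∈ outP v, (1 - q s(v p.1, p.2))
  set Q := ∏ p ∈ outP v, Real.exp (-q s(v p.1, p.2))
  have hA0 : 0 ≤ A := Finset.prod_nonneg fun _ _ => a _
  have hA1 : A ≤ 1 := Finset.prod_le_one (fun _ _ => a _) (fun _ _ => b _)
  have hP0 : 0 ≤ P := Finset.prod_nonneg fun _ _ => a _
  have hP1 : P ≤ 1 := Finset.prod_le_one (fun _ _ => a _) (fun _ _ => b _)
  have hD0 : 0 ≤ D := Finset.prod_nonneg fun _ _ => hc0 _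
  have hD1 : D ≤ 1 := Finset.prod_le_one (fun _ _ => hc0 _) (fun _ _ => hc1 _)
  have hQ0 : 0 ≤ Q := Finset.prod_nonneg fun _ _ => hc0 _
  have hQ1 : Q ≤ 1 := Finset.prod_le_one (fun _ _ => hc0 _) (fun _ _ => hc1 _)
  have hA : 1 - A ≤ Fintype.card (Sym2 (Fin k)) * δ := by
    have := abs_prod_sub_le (nd k \ H.edgeFinset) (fun e => 1 - q (e.map v)) (fun _ => 1) (fun _ _ => a _) (fun _ _ => b _)
      (fun _ _ => zero_le_one) (fun _ _ => le_rfl)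
    simp only [Finset.prod_const_one, sub_sub_cancel_left, abs_neg] at this
    calc 1 - A ≤ |A - 1| := by rw [abs_sub_comm]; exact le_abs_self _
      _ ≤ _ := this
      _ ≤ ∑ e : Sym2 (Fin k), |q (e.map v)| := 
        Finset.sum_le_sum_of_subset_of_nonneg (Finset.subset_univ _) (fun _ _ _ => abs_nonneg _)
      _ ≤ ∑ e : Sym2 (Fin k), δ := Finset.sum_le_sum fun e _ => by rw [abs_of_nonneg (h0 _)]; exact hδ _
      _ = _ := by simp
  have hD : 1 - D ≤ k * k * δ := by
    have h2 : D = Real.exp (-∑ p ∈ S, q s(v p.1, p.2)) := by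
      rw [← Finset.sum_neg_distrib, Real.exp_sum]
    have h3 := Real.add_one_le_exp (-∑ p ∈ S, q s(v p.1, p.2))
    have h4 : ∑ p ∈ S, q s(v p.1, p.2) ≤ ∑ p ∈ S, δ := Finset.sum_le_sum fun e _ => hδ _
    have h5 : ∑ p ∈ S, δ = k * k * δ := by simp [hS]
    linarith
  have hPQ : |P - Q| ≤ k * Fintype.card V * δ^2 := by
    refine (abs_prod_sub_le _ _ _ (fun _ _ => a _) (fun _ _ => b _) (fun _ _ => hc0 _) (fun _ _ => hc1 _)).trans ?_
    calc _ ≤ ∑ p : Fin k × V, |(1 - q s(v p.1, p.2)) - Real.exp (-q s(v p.1, p.2))| := 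
        Finset.sum_le_sum_of_subset_of_nonneg (Finset.subset_univ _) (fun _ _ _ => abs_nonneg _)
      _ ≤ ∑ p : Fin k × V, δ^2 := Finset.sum_le_sum fun p _ => by
          have := Real.abs_exp_sub_one_sub_id_le (x := -q s(v p.1, p.2)) (by 
            rw [abs_neg, abs_of_nonneg (h0 _)]; exact h1 _)
          rw [abs_sub_comm]
          calc _ = |Real.exp (-q s(v p.1, p.2)) - 1 - -q s(v p.1, p.2)| := by congr 1; ring
            _ ≤ _ := this
            _ = (q s(v p.1, p.2))^2 := by ring
            _ ≤ _ := pow_le_pow_left₀ (h0 _) (hδ _) 2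
      _ = _ := by simp [Fintype.card_prod]
  rw [hexp]
  have e : RB q v H - D * Q = (P - Q) - (1 - A) * P + (1 - D) * Q := by
    simp only [RB]; ring
  have e1 : 0 ≤ (1 - A) * P := mul_nonneg (by linarith) hP0
  have e2 : (1 - A) * P ≤ 1 - A := mul_le_of_le_one_right (by linarith) hP1
  have e3 : 0 ≤ (1 - D) * Q := mul_nonneg (by linarith) hQ0
  have e4 : (1 - D) * Q ≤ 1 - D := mul_le_of_le_one_right (by linarith) hQ1
  rw [e]
  obtain ⟨h6, h7⟩ := abs_le.1 hPQ
  rw [abs_le]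
  constructor <;> linarith

lemma cheb (hk : 1 ≤ k) (h0 : ∀ e, 0 ≤ q e) (h1 : ∀ e, q e ≤ 1) {δ : ℝ} (hδ : ∀ e, q e ≤ δ) (hδ1 : δ < 1) (hδ0 : 0 ≤ δ)
    (n : ℕ) (hn : 0 < n) (c ε : ℝ) (hε : 0 < ε) (x : ℝ) 
    (hx : x = (∑ v : Fin k ↪ V, ∑ H ∈ conn k, PB q v H) / n) :
    Measure.pi (fun e => bern (q e)) {ω | ε ≤ |(Nk (graphOf ω) k : ℝ) / n - c|} ≤ 
      ENNReal.ofReal (((k.factorial * x / n + x^2) / (((k-1).factorial : ℝ)^2 * (1-δ)^(k^2)) - 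
        2 * c * (x / (k-1).factorial) + c^2) / ε^2) := by
  have hn' : (0:ℝ) < n := by exact_mod_cast hn
  have hf : (0:ℝ) < ((k-1).factorial : ℝ) := by exact_mod_cast Nat.factorial_pos _
  refine (meas_le h0 h1 _ (fun ω => ((Xc k (graphOf ω)) / (((k-1).factorial : ℝ) * n) - c)^2 / ε^2) 
    (fun ω => by positivity) ?_).trans (ENNReal.ofReal_le_ofReal ?_)
  · intro ω hω
    rw [Set.mem_setOf_eq] at hω
    rw [count hk, mul_div_mul_left _ _ hf.ne', le_div_iff₀ (by positivity), one_mul, 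
      ← sq_abs ((Nk (graphOf ω) k : ℝ) / n - c)]
    exact pow_le_pow_left₀ hε.le hω 2
  · set f := ((k-1).factorial : ℝ) with hfd
    have e1 : Ex q (fun ω => ((Xc k (graphOf ω)) / (f * n) - c)^2 / ε^2) =
      (Ex q (fun ω => (Xc k (graphOf ω))^2) / (f*n)^2 - 2 * c * (Ex q (fun ω => (Xc k (graphOf ω))) / (f * n)) + c^2) / ε^2 := by
      have : (fun ω : Sym2 V → Bool => ((Xc k (graphOf ω)) / (f * n) - c)^2 / ε^2) = fun ω => 
        (1/ ((f*n)^2 * ε^2)) * (Xc k (graphOf ω))^2 + ((- (2 * c / ((f * n) * ε^2))) * (Xc k (graphOf ω)) + c^2/ε^2) := by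
        ext ω
        field_simp
        ring
      rw [this, Ex_add, Ex_add, Ex_const_mul, Ex_const_mul, Ex_const]
      field_simp
      ring
    have hX : Ex q (fun ω => (Xc k (graphOf ω))) = x * n := by
      rw [Ex_Xc, hx]; field_simp
    have h2 := second (k := k) h0 h1 hδ hδ1.le hδ0
    have hp : 0 < (1-δ)^(k^2) := pow_pos (by linarith) _
    rw [e1]
    rw [hX] at h2 ⊢
    have h3 : Ex q (fun ω => (Xc k (graphOf ω))^2) / (f*n)^2 ≤ (k.factorial * x / n + x^2) / (f^2 * (1-δ)^(k^2)) := by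
      rw [div_le_div_iff₀ (by positivity) (by positivity)]
      calc _ = f^2 * ((1 - δ) ^ (k^2) * Ex q (fun ω => (Xc k (graphOf ω))^2)) := by ring
        _ ≤ f^2 * (k.factorial * (x * n) + (x * n)^2) := by gcongr
        _ = _ := by field_simp
    have h4 : x * n / (f * n) = x / f := by field_simp
    rw [h4]
    gcongr

end G
end Percolation

namespace Percolation
open MeasureTheory Filter Topology
open Classical

lemma desc_tendsto (k : ℕ) : Tendsto (fun n : ℕ => ((n:ℝ)^k - n.descFactorial k) / (n:ℝ)^k) atTop (𝓝 0) := by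
  have h1 := isEquivalent_descFactorial k
  have h2 := (Asymptotics.isEquivalent_iff_tendsto_one (by 
    filter_upwards [eventually_gt_atTop 0] with n hn
    have : (n:ℝ) ≠ 0 := by exact_mod_cast hn.ne'
    positivity)).1 h1
  have h3 := (tendsto_const_nhds (x := (1:ℝ))).sub h2
  rw [sub_self] at h3
  refine h3.congr' ?_
  filter_upwards [eventually_gt_atTop 0] with n hn
  have : (n:ℝ) ≠ 0 := by exact_mod_cast hn.ne'
  simp only [Pi.div_apply]
  field_simp

lemma emb_diff {n k : ℕ} (g : (Fin k → Fin n) → ℝ) (M : ℝ) (hM : ∀ v, |g v| ≤ M) :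
    |∑ v : Fin k ↪ Fin n, g v - ∑ v : Fin k → Fin n, g v| ≤ M * ((n:ℝ)^k - n.descFactorial k) := by
  set S : Finset (Fin k → Fin n) := Finset.univ.map ⟨fun v : Fin k ↪ Fin n => (v : Fin k → Fin n), DFunLike.coe_injective⟩ with hS
  have h1 : ∑ v : Fin k ↪ Fin n, g v = ∑ v ∈ S, g v := by rw [hS, Finset.sum_map]; rfl
  have h2 := Finset.sum_add_sum_compl S g
  have h3 : (Sᶜ.card : ℝ) = (n:ℝ)^k - n.descFactorial k := by
    rw [Finset.card_compl, Nat.cast_sub (Finset.card_le_univ _)]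
    simp [hS, Fintype.card_embedding_eq]
  rw [h1, ← h2, ← h3, sub_add_cancel_left, abs_neg]
  calc _ ≤ ∑ v ∈ Sᶜ, |g v| := Finset.abs_sum_le_sum_abs _ _
    _ ≤ ∑ v ∈ Sᶜ, M := Finset.sum_le_sum fun v _ => hM v
    _ = _ := by simp [mul_comm]

lemma card_emb_le (n k : ℕ) : (Fintype.card (Fin k ↪ Fin n) : ℝ) ≤ (n:ℝ)^k := by
  rw [Fintype.card_embedding_eq]
  simp only [Fintype.card_fin]
  exact_mod_cast Nat.descFactorial_le_pow n k

def qn (β : ∀ n : ℕ, Fin n → Fin n → ℝ) (n : ℕ) (e : Sym2 (Fin n)) : ℝ := 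
  min (1 / n * sym2Val (β n) e) 1

section
variable (β : ∀ n : ℕ, Fin n → Fin n → ℝ) (B : ℝ)
    (hsym : ∀ n i j, β n i j = β n j i)
    (hnonneg : ∀ n i j, 0 ≤ β n i j)
    (hbound : ∀ n i j, β n i j ≤ B) (hB : 1 ≤ B)

include hnonneg in
lemma qn_nonneg (n : ℕ) (e : Sym2 (Fin n)) : 0 ≤ qn β n e :=
  le_min (mul_nonneg (by positivity) (sym2Val_nonneg _ (hnonneg n) e)) zero_le_one

lemma qn_le_one (n : ℕ) (e : Sym2 (Fin n)) : qn β n e ≤ 1 := min_le_right _ _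

include hbound in
lemma qn_le (n : ℕ) (e : Sym2 (Fin n)) : qn β n e ≤ B / n := by
  refine (min_le_left _ _).trans ?_
  rw [one_div, div_eq_inv_mul]
  exact mul_le_mul_of_nonneg_left (sym2Val_le _ B (hbound n) e) (by positivity)

include hbound hB in
lemma qn_eq (n : ℕ) (hn : B < n) (e : Sym2 (Fin n)) : qn β n e = sym2Val (β n) e / n := by
  have : (0:ℝ) < n := by linarith
  rw [qn, min_eq_left]
  · ring
  · rw [one_div, inv_mul_le_iff₀ this]
    linarith [sym2Val_le _ B (hbound n) e]

include hbound hB in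
lemma PB_formula {k : ℕ} (n : ℕ) (hn : B < n) (v : Fin k ↪ Fin n) (H : SimpleGraph (Fin k)) :
    PB (qn β n) v H = (edgeProd H fun i j => β n (v i) (v j)) * RB (qn β n) v H / (n:ℝ)^(Nat.card H.edgeSet) := by
  rw [PB_eq, edgeProd_eq]
  have : ∏ e ∈ H.edgeFinset, qn β n (e.map v) = 
    (∏ e ∈ H.edgeFinset, sym2Val (fun i j => β n (v i) (v j)) e) / (n:ℝ)^(Nat.card H.edgeSet) := by
    rw [Nat.card_eq_fintype_card, ← SimpleGraph.edgeFinset_card, ← Finset.prod_const, ← Finset.prod_div_distrib]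
    refine Finset.prod_congr rfl fun e _ => ?_
    rw [qn_eq β B hbound hB n hn, sym2Val_map]
  rw [this]
  ring

include hnonneg hbound hB in
lemma nontree_tendsto {k : ℕ} (H : SimpleGraph (Fin k)) (hH : k ≤ Nat.card H.edgeSet) :
    Tendsto (fun n : ℕ => (∑ v : Fin k ↪ Fin n, PB (qn β n) v H) / n) atTop (𝓝 0) := by
  have hl : Tendsto (fun n : ℕ => B^(k^2) / (n:ℝ)) atTop (𝓝 0) := tendsto_const_div_atTop_nhds_zero_nat _
  have hev : ∀ᶠ n : ℕ in atTop, B < n := by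
    have := tendsto_natCast_atTop_atTop (R := ℝ)
    exact this.eventually_gt_atTop B
  refine squeeze_zero' (.of_forall fun n => ?_) ?_ hl
  · exact div_nonneg (Finset.sum_nonneg fun v _ => PB_nonneg (qn_nonneg β hnonneg n) (qn_le_one β n) v H) (by positivity)
  · filter_upwards [hev] with n hn
    have hn0 : (0:ℝ) < n := by linarith
    have hn1 : (1:ℝ) ≤ n := by linarith
    gcongr
    calc _ ≤ ∑ v : Fin k ↪ Fin n, B^(k^2) / (n:ℝ)^k := by
          refine Finset.sum_le_sum fun v _ => ?_
          rw [PB_formula β B hbound hB n hn]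
          have h1 := edgeProd_le H (fun i j => β n (v i) (v j)) B (fun _ _ => hnonneg _ _ _) (fun _ _ => hbound _ _ _) hB
          have h0 := edgeProd_nonneg H (fun i j => β n (v i) (v j)) (fun _ _ => hnonneg _ _ _)
          have h2 := RB_bounds (qn_nonneg β hnonneg n) (qn_le_one β n) v H
          gcongr
          exact (mul_le_of_le_one_right h0 h2.2).trans h1
      _ = Fintype.card (Fin k ↪ Fin n) * (B^(k^2) / (n:ℝ)^k) := by simp
      _ ≤ (n:ℝ)^k * (B^(k^2) / (n:ℝ)^k) := by gcongr; exact card_emb_le n k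
      _ = _ := by field_simp

include hsym hnonneg hbound hB in
lemma tree_tendsto {k : ℕ} (H : SimpleGraph (Fin k)) (hH : Nat.card H.edgeSet + 1 = k)
    (W : ℝ → ℝ → ℝ) (hW : IsGraphon W) (hconv : ConvergesTo β W) :
    Tendsto (fun n : ℕ => (∑ v : Fin k ↪ Fin n, PB (qn β n) v H) / n) atTop (𝓝 
      (∫ x : Fin k → ℝ in Set.univ.pi fun _ => I01,
        (edgeProd H fun i j => W (x i) (x j)) * ∏ i, Real.exp (-lambdaW W (x i)))) := by
  have hev : ∀ᶠ n : ℕ in atTop, B < n := by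
    have := tendsto_natCast_atTop_atTop (R := ℝ)
    exact this.eventually_gt_atTop B
  have hY := weighted_tendsto β B hsym hnonneg hbound W hW hconv H
  set C : ℝ := Fintype.card (Sym2 (Fin k)) * B + k * k * B + k * B^2 with hC
  have hCl : Tendsto (fun n : ℕ => B^(k^2) * (C / (n:ℝ)) + B^(k^2) * (((n:ℝ)^k - n.descFactorial k) / (n:ℝ)^k)) atTop (𝓝 0) := by
    have := ((tendsto_const_div_atTop_nhds_zero_nat C).const_mul (B^(k^2))).add ((desc_tendsto k).const_mul (B^(k^2)))
    simpa using this
  refine tendsto_of_tendsto_of_dist hY (squeeze_zero' (.of_forall fun n => dist_nonneg) ?_ hCl)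
  filter_upwards [hev] with n hn
  have hn0 : (0:ℝ) < n := by linarith
  set ep : (Fin k → Fin n) → ℝ := fun v => edgeProd H fun i j => β n (v i) (v j) with hep
  set ex : (Fin k → Fin n) → ℝ := fun v => Real.exp (-∑ i, (∑ u, β n (v i) u) / n) with hex
  have h1 : ∀ v, ep v ≤ B^(k^2) := fun v => edgeProd_le H (fun i j => β n (v i) (v j)) B (fun _ _ => hnonneg _ _ _) (fun _ _ => hbound _ _ _) hB
  have h0 : ∀ v, 0 ≤ ep v := fun v => edgeProd_nonneg H (fun i j => β n (v i) (v j)) (fun _ _ => hnonneg _ _ _)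
  have hx0 : ∀ v, 0 ≤ ex v := fun v => (Real.exp_pos _).le
  have hx1 : ∀ v, ex v ≤ 1 := fun v => by
    refine Real.exp_le_one_iff.2 (neg_nonpos.2 (Finset.sum_nonneg fun i _ => div_nonneg (Finset.sum_nonneg fun u _ => hnonneg _ _ _) hn0.le))
  have hexq : ∀ v : Fin k ↪ Fin n, ex v = Real.exp (-∑ i, ∑ u, qn β n s(v i, u)) := by
    intro v
    simp only [hex]
    congr 2
    refine Finset.sum_congr rfl fun i _ => ?_
    rw [Finset.sum_div]
    refine Finset.sum_congr rfl fun u _ => ?_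
    rw [qn_eq β B hbound hB n hn, sym2Val_mk _ (hsym n)]
  have hR : ∀ v : Fin k ↪ Fin n, |RB (qn β n) v H - ex v| ≤ C / n := by
    intro v
    rw [hexq]
    refine (RB_est (qn_nonneg β hnonneg n) (qn_le_one β n) (qn_le β B hbound n) v H).trans (le_of_eq ?_)
    rw [hC, Fintype.card_fin]
    field_simp
  have hsum : (∑ v : Fin k ↪ Fin n, PB (qn β n) v H) / n = (∑ v : Fin k ↪ Fin n, ep v * RB (qn β n) v H) / (n:ℝ)^k := by
    rw [Finset.sum_congr rfl fun v _ => PB_formula β B hbound hB n hn v H, ← Finset.sum_div, div_div, ← pow_succ, hH]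
  have hd1 : |∑ v : Fin k ↪ Fin n, ep v * RB (qn β n) v H - ∑ v : Fin k ↪ Fin n, ep v * ex v| ≤ (n:ℝ)^k * (B^(k^2) * (C / n)) := by
    rw [← Finset.sum_sub_distrib]
    have hC0 : 0 ≤ C := by positivity
    calc _ ≤ ∑ v : Fin k ↪ Fin n, |ep v * RB (qn β n) v H - ep v * ex v| := Finset.abs_sum_le_sum_abs _ _
      _ ≤ ∑ v : Fin k ↪ Fin n, B^(k^2) * (C / n) := by
        refine Finset.sum_le_sum fun v _ => ?_
        rw [← mul_sub, abs_mul, abs_of_nonneg (h0 v)]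
        exact mul_le_mul (h1 v) (hR v) (abs_nonneg _) (by positivity)
      _ = Fintype.card (Fin k ↪ Fin n) * (B^(k^2) * (C / n)) := by simp
      _ ≤ _ := by gcongr; exact card_emb_le n k
  have hd2 := emb_diff (fun v => ep v * ex v) (B^(k^2)) (fun v => by
    rw [abs_of_nonneg (mul_nonneg (h0 v) (hx0 v))]
    exact (mul_le_of_le_one_right (h0 v) (hx1 v)).trans (h1 v))
  rw [Real.dist_eq, abs_sub_comm, hsum, ← sub_div, abs_div, abs_of_nonneg (by positivity : (0:ℝ) ≤ (n:ℝ)^k), div_le_iff₀ (by positivity)]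
  have ht := abs_sub_le (∑ v : Fin k ↪ Fin n, ep v * RB (qn β n) v H) (∑ v : Fin k ↪ Fin n, ep v * ex v) (∑ v : Fin k → Fin n, ep v * ex v)
  refine ht.trans ((add_le_add hd1 hd2).trans (le_of_eq ?_))
  field_simp

include hsym hnonneg hbound hB in
lemma first_tendsto {k : ℕ} (W : ℝ → ℝ → ℝ) (hW : IsGraphon W) (hconv : ConvergesTo β W) :
    Tendsto (fun n : ℕ => (∑ v : Fin k ↪ Fin n, ∑ H ∈ conn k, PB (qn β n) v H) / n) atTop (𝓝 
      ((k-1).factorial * treeLimit k W)) := by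
  have hf : ((k-1).factorial : ℝ) ≠ 0 := by exact_mod_cast Nat.factorial_ne_zero _
  have e1 : (k-1).factorial * treeLimit k W = ∑ H ∈ conn k, if H.IsTree then 
      ∫ x : Fin k → ℝ in Set.univ.pi fun _ => I01,
        (edgeProd H fun i j => W (x i) (x j)) * ∏ i, Real.exp (-lambdaW W (x i)) else 0 := by
    unfold treeLimit
    rw [← mul_assoc, mul_one_div_cancel hf, one_mul, conn, Finset.sum_filter]
    refine Finset.sum_congr (by congr!) fun H _ => ?_
    by_cases hT : H.IsTree
    · rw [if_pos hT, if_pos hT.1]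
    · simp [hT]
  rw [e1]
  have e2 : (fun n : ℕ => (∑ v : Fin k ↪ Fin n, ∑ H ∈ conn k, PB (qn β n) v H) / (n:ℝ)) = 
    fun n : ℕ => ∑ H ∈ conn k, (∑ v : Fin k ↪ Fin n, PB (qn β n) v H) / (n:ℝ) := by
    ext n
    rw [Finset.sum_comm, Finset.sum_div]
  rw [e2]
  refine tendsto_finset_sum _ fun H hH => ?_
  have hc : H.Connected := (Finset.mem_filter.1 hH).2
  split_ifs with hT
  · have := (SimpleGraph.isTree_iff_connected_and_card.1 hT).2
    rw [Nat.card_fin] at this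
    exact tree_tendsto β B hsym hnonneg hbound hB H this W hW hconv
  · refine nontree_tendsto β B hnonneg hbound hB H ?_
    have h1 := hc.card_vert_le_card_edgeSet_add_one
    have h2 : ¬ (Nat.card H.edgeSet + 1 = Nat.card (Fin k)) := fun h => 
      hT (SimpleGraph.isTree_iff_connected_and_card.2 ⟨hc, h⟩)
    rw [Nat.card_fin] at h1 h2
    omega

end
end Percolation

open Percolation MeasureTheory Filter Topology in
/-- If `(G_n)` converges to a graphon `W`, then for each fixed `k ≥ 1`
the number `N_k` of vertices of `G_n(1/n)` in components with exactly `k` vertices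
satisfies `N_k/n → (1/(k-1)!) Σ_T ∫ ∏_{ij∈E(T)} W(x_i,x_j) ∏_i e^{-λ(x_i)} dx` in
probability, the sum running over all trees on `{1, …, k}`. -/
theorem vertices_in_small_components
    (β : ∀ n : ℕ, Fin n → Fin n → ℝ) (βmax : ℝ)
    (hsym : ∀ n i j, β n i j = β n j i)
    (hnonneg : ∀ n i j, 0 ≤ β n i j)
    (hdiag : ∀ n i, β n i i = 0)
    (hbound : ∀ n i j, β n i j ≤ βmax)
    (W : ℝ → ℝ → ℝ) (hW : IsGraphon W) (hconv : ConvergesTo β W)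
    (k : ℕ) (hk : 1 ≤ k) :
    ∀ ε > 0, Tendsto
      (fun n : ℕ => percMeasure (β n) (1 / n)
        {ω | ε ≤ |(Nk (graphOf ω) k : ℝ) / n - treeLimit k W|})
      atTop (nhds 0) := by
  intro ε hε
  set B : ℝ := max 1 βmax with hBd
  have hB : 1 ≤ B := le_max_left _ _
  have hb : ∀ n i j, β n i j ≤ B := fun n i j => (hbound n i j).trans (le_max_right _ _)
  set f : ℝ := ((k-1).factorial : ℝ) with hf
  have hf0 : f ≠ 0 := by rw [hf]; exact_mod_cast Nat.factorial_ne_zero _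
  set c := treeLimit k W with hc
  set x : ℕ → ℝ := fun n => (∑ v : Fin k ↪ Fin n, ∑ H ∈ conn k, PB (qn β n) v H) / n with hx
  have hxl : Tendsto x atTop (𝓝 (f * c)) := first_tendsto β B hsym hnonneg hb hB W hW hconv
  have hlim : Tendsto (fun n : ℕ => ((k.factorial * x n / n + (x n)^2) / (f^2 * (1 - B/n)^(k^2)) - 
        2 * c * (x n / f) + c^2) / ε^2) atTop (𝓝 0) := by
    have h1 : Tendsto (fun n : ℕ => k.factorial * x n / n) atTop (𝓝 0) := 
      (hxl.const_mul (k.factorial : ℝ)).div_atTop tendsto_natCast_atTop_atTop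
    have h2 : Tendsto (fun n : ℕ => f^2 * (1 - B/(n:ℝ))^(k^2)) atTop (𝓝 (f^2 * (1 - 0)^(k^2))) :=
      ((tendsto_const_nhds.sub (tendsto_const_div_atTop_nhds_zero_nat B)).pow _).const_mul _
    have h3 := ((((h1.add (hxl.pow 2)).div h2 (by simpa using hf0)).sub ((hxl.div_const f).const_mul (2 * c))).add_const (c^2)).div_const (ε^2)
    have e0 : (0:ℝ) = ((0 + (f*c)^2)/(f^2*(1-0)^(k^2)) - 2*c*(f*c/f) + c^2)/ε^2 := by
      rw [sub_zero, one_pow]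
      field_simp
      ring
    rw [e0]
    exact h3
  have hlim' := ENNReal.tendsto_ofReal hlim
  rw [ENNReal.ofReal_zero] at hlim'
  refine tendsto_of_tendsto_of_tendsto_of_le_of_le' tendsto_const_nhds hlim' (.of_forall fun n => bot_le) ?_
  filter_upwards [(tendsto_natCast_atTop_atTop (R := ℝ)).eventually_gt_atTop B] with n hn
  have hn0 : (0:ℝ) < n := by linarith
  exact cheb hk (qn_nonneg β hnonneg n) (qn_le_one β n) (qn_le β B hb n) 
    ((div_lt_one hn0).2 hn) (by positivity) n (by exact_mod_cast hn0) c ε hε (x n) rfl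
end
end
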